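/- arXiv:2112.04927 — 10 statements merged into one kernel-verified Lean document; each statement's English description precedes it below -/
import Mathlib

section
/- Let L be a complete lattice that is modular and upper continuous, and let C₁ and C₂ be two well-ordered chains in L. Then there exists a subset S ⊆ L with C₁ ∪ C₂ ⊆ S such that S is closed under arbitrary suprema and infima computed in L (for every T ⊆ S, sSup T ∈ S and sInf T ∈ S) and S is completely distributive: for every index type ι, every family of index types κ : ι → Type, and every doubly indexed family f with f i j ∈ S for all i and all j : κ i, one has ⨅ i, ⨆ j, f i j = ⨆ (g : Π i, κ i), ⨅ i, f i (g i), all suprema and infima computed in L. -/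
universe u w

namespace WellOrderedChains

/-- Every nonempty subset of `A` has a least element. In particular `A` is a chain. -/
def WellOrdered {L : Type*} [LE L] (A : Set L) : Prop :=
  ∀ T ⊆ A, T.Nonempty → ∃ m ∈ T, ∀ x ∈ T, m ≤ x

/-- The set of all suprema of subsets of `G`. -/
def supSpan {L : Type*} [CompleteLattice L] (G : Set L) : Set L :=
  {x | ∃ T ⊆ G, sSup T = x}

/-- The set of all infima of subsets of `G`. -/
def infSpan {L : Type*} [CompleteLattice L] (G : Set L) : Set L :=
  {x | ∃ T ⊆ G, sInf T = x}

namespace WellOrdered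

variable {L : Type*} [PartialOrder L] {A : Set L}

theorem le_total (hA : WellOrdered A) {x y : L} (hx : x ∈ A) (hy : y ∈ A) : x ≤ y ∨ y ≤ x := by
  obtain ⟨m, hm, h⟩ := hA {x, y} (Set.insert_subset hx (Set.singleton_subset_iff.2 hy)) ⟨x, by simp⟩
  rcases hm with rfl | rfl
  · exact .inl (h _ (by simp))
  · exact .inr (h _ (by simp))

theorem lt_of_not_le (hA : WellOrdered A) {x y : L} (hx : x ∈ A) (hy : y ∈ A) (h : ¬ x ≤ y) :
    y < x :=
  lt_of_le_not_ge ((hA.le_total hx hy).resolve_left h) h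

theorem induction (hA : WellOrdered A) {P : L → Prop}
    (h : ∀ x ∈ A, (∀ y ∈ A, y < x → P y) → P x) : ∀ x ∈ A, P x := by
  by_contra! hne
  obtain ⟨x, hx, hPx⟩ := hne
  obtain ⟨m, ⟨hm, hPm⟩, hmin⟩ := hA {x ∈ A | ¬ P x} (fun _ h => h.1) ⟨x, hx, hPx⟩
  refine hPm (h m hm fun y hy hlt => ?_)
  by_contra hPy
  exact hlt.not_ge (hmin y ⟨hy, hPy⟩)

theorem insert_top [OrderTop L] (hA : WellOrdered A) : WellOrdered (insert ⊤ A) := by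
  intro T hT hne
  by_cases h : (T ∩ A).Nonempty
  · obtain ⟨m, hm, hmin⟩ := hA (T ∩ A) Set.inter_subset_right h
    refine ⟨m, hm.1, fun x hx => ?_⟩
    rcases hT hx with rfl | hxA
    · exact le_top
    · exact hmin x ⟨hx, hxA⟩
  · have htop : ∀ x ∈ T, x = ⊤ := fun x hx =>
      (hT hx).resolve_right fun hxA => h ⟨x, hx, hxA⟩
    obtain ⟨x, hx⟩ := hne
    exact ⟨x, hx, fun y hy => by rw [htop x hx, htop y hy]⟩

end WellOrdered

variable {L : Type*} [CompleteLattice L] {A B G : Set L}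

theorem subset_supSpan (G : Set L) : G ⊆ supSpan G :=
  fun x hx => ⟨{x}, by simpa using hx, by simp⟩

theorem subset_infSpan (G : Set L) : G ⊆ infSpan G :=
  fun x hx => ⟨{x}, by simpa using hx, by simp⟩

theorem sSup_mem_supSpan {T : Set L} (hT : T ⊆ supSpan G) : sSup T ∈ supSpan G := by
  refine ⟨{g ∈ G | g ≤ sSup T}, fun _ h => h.1, le_antisymm (sSup_le fun _ h => h.2) ?_⟩
  refine sSup_le fun x hx => ?_
  obtain ⟨U, hU, rfl⟩ := hT hx
  exact sSup_le_sSup fun g hg => ⟨hU hg, (le_sSup hg).trans (le_sSup hx)⟩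

theorem sInf_mem_infSpan {T : Set L} (hT : T ⊆ infSpan G) : sInf T ∈ infSpan G :=
  sSup_mem_supSpan (L := Lᵒᵈ) hT

theorem sup_mem_supSpan {x y : L} (hx : x ∈ supSpan G) (hy : y ∈ supSpan G) :
    x ⊔ y ∈ supSpan G := by
  rw [← sSup_pair]
  exact sSup_mem_supSpan (Set.insert_subset hx (Set.singleton_subset_iff.2 hy))

theorem inf_mem_infSpan {x y : L} (hx : x ∈ infSpan G) (hy : y ∈ infSpan G) :
    x ⊓ y ∈ infSpan G :=
  sup_mem_supSpan (L := Lᵒᵈ) hx hy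

theorem WellOrdered.supSpan (hG : WellOrdered G) : WellOrdered (supSpan G) := by
  intro U hU ⟨x₀, hx₀⟩
  by_cases h : {c ∈ G | ∃ x ∈ U, ¬ c ≤ x}.Nonempty
  · obtain ⟨m, ⟨hmG, x, hxU, hmx⟩, hmin⟩ := hG _ (fun _ h => h.1) h
    refine ⟨x, hxU, fun y hy => ?_⟩
    obtain ⟨T, hT, rfl⟩ := hU hxU
    refine sSup_le fun t ht => ?_
    by_contra hty
    exact hmx ((hmin t ⟨hT ht, y, hy, hty⟩).trans (le_sSup ht))
  · refine ⟨x₀, hx₀, fun y hy => ?_⟩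
    obtain ⟨T, hT, rfl⟩ := hU hx₀
    refine sSup_le fun t ht => ?_
    by_contra hty
    exact h ⟨t, hT ht, y, hy, hty⟩

/-- An infimum of joins of elements of two well-ordered chains is a supremum of meets. -/
theorem inf_iInf_mem_supSpan [IsModularLattice L] (hA : WellOrdered A) (hB : WellOrdered B)
    (hAtop : ⊤ ∈ A) :
    ∀ β ∈ B, ∀ E ⊆ A ×ˢ B, (∀ p ∈ E, p.2 < β) →
      β ⊓ ⨅ p ∈ E, p.1 ⊔ p.2 ∈ supSpan (Set.image2 (· ⊓ ·) A B) := by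
  refine hB.induction fun β hβ ih E hE hlt => ?_
  obtain rfl | hne := E.eq_empty_or_nonempty
  · exact subset_supSpan _ ⟨⊤, hAtop, β, hβ, by simp⟩
  obtain ⟨a, ⟨p, hp, rfl⟩, hamin⟩ := hA (Prod.fst '' E)
    (by rintro _ ⟨q, hq, rfl⟩; exact (hE hq).1) (hne.image _)
  obtain ⟨b, ⟨q, ⟨hq, hqp⟩, rfl⟩, hbmin⟩ := hB (Prod.snd '' {q ∈ E | q.1 = p.1})
    (by rintro _ ⟨q, hq, rfl⟩; exact (hE hq.1).2) ⟨p.2, p, ⟨hp, rfl⟩, rfl⟩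
  set y := ⨅ r ∈ {r ∈ E | r.2 < q.2}, r.1 ⊔ r.2 with hy
  have hqy : q.1 ≤ y := le_iInf₂ fun r hr => by
    rw [hqp]
    exact (hamin r.1 ⟨r, hr.1, rfl⟩).trans le_sup_left
  have key : ⨅ r ∈ E, r.1 ⊔ r.2 = (q.1 ⊔ q.2) ⊓ y := by
    apply le_antisymm
    · exact le_inf (iInf₂_le q hq) (le_iInf₂ fun r hr => iInf₂_le r hr.1)
    · refine le_iInf₂ fun r hr => ?_
      by_cases h : q.2 ≤ r.2
      · refine inf_le_left.trans (sup_le_sup ?_ h)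
        rw [hqp]
        exact hamin r.1 ⟨r, hr, rfl⟩
      · exact inf_le_right.trans
          (iInf₂_le r ⟨hr, hB.lt_of_not_le (hE hq).2 (hE hr).2 h⟩)
  have hmod : β ⊓ ((q.1 ⊔ q.2) ⊓ y) = (q.1 ⊓ β) ⊔ (q.2 ⊓ y) := by
    rw [sup_inf_assoc_of_le q.2 hqy, inf_comm, sup_comm q.1,
      sup_inf_assoc_of_le q.1 (inf_le_left.trans (hlt q hq).le), sup_comm]
  rw [key, hmod]
  refine sup_mem_supSpan (subset_supSpan _ ⟨q.1, (hE hq).1, β, hβ, rfl⟩) ?_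
  exact ih q.2 (hE hq).2 (hlt q hq) _ (fun r hr => hE hr.1) fun r hr => hr.2

theorem infSpan_subset_supSpan [IsModularLattice L] (hA : WellOrdered A) (hB : WellOrdered B)
    (hAtop : ⊤ ∈ A) (hBtop : ⊤ ∈ B) :
    infSpan (Set.image2 (· ⊔ ·) A B) ⊆ supSpan (Set.image2 (· ⊓ ·) A B) := by
  rintro _ ⟨T, hT, rfl⟩
  have h := inf_iInf_mem_supSpan hA hB hAtop ⊤ hBtop
    {p ∈ A ×ˢ B | p.1 ⊔ p.2 ∈ T ∧ p.2 < ⊤} (fun _ h => h.1) fun _ h => h.2.2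
  convert h using 1
  rw [top_inf_eq]
  apply le_antisymm
  · exact le_iInf₂ fun p hp => sInf_le hp.2.1
  · refine le_sInf fun t ht => ?_
    obtain ⟨a, ha, b, hb, rfl⟩ := hT ht
    by_cases hbt : b = ⊤
    · simp [hbt]
    · exact iInf₂_le (a, b) ⟨⟨ha, hb⟩, ht, lt_top_iff_ne_top.2 hbt⟩

/-- A supremum of meets of elements of two sup-closed well-ordered chains is an infimum
of joins. -/
theorem sup_iSup_mem_infSpan [IsModularLattice L] (hA : WellOrdered A) (hB : WellOrdered B)
    (hAsup : ∀ T ⊆ A, sSup T ∈ A) (hBsup : ∀ T ⊆ B, sSup T ∈ B)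
    (hAuc : ∀ (x : L), ∀ T ⊆ A, x ⊓ sSup T = ⨆ t ∈ T, x ⊓ t)
    (hBuc : ∀ (x : L), ∀ T ⊆ B, x ⊓ sSup T = ⨆ t ∈ T, x ⊓ t) :
    ∀ β ∈ B, ∀ D ⊆ A ×ˢ B, sSup (Prod.snd '' D) = β → ∀ c ∈ A, (∀ p ∈ D, c ≤ p.1) →
      c ⊔ ⨆ p ∈ D, p.1 ⊓ p.2 ∈ infSpan (Set.image2 (· ⊔ ·) A B) := by
  refine hB.induction fun β hβ ih D hD hDβ c hc hcD => ?_
  have hbot : (⊥ : L) ∈ B := by simpa using hBsup ∅ (Set.empty_subset _)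
  let ψ : L → L := fun a => sSup (Prod.snd '' {p ∈ D | a ≤ p.1})
  have hψB : ∀ a, Prod.snd '' {p ∈ D | a ≤ p.1} ⊆ B := by
    rintro a _ ⟨p, hp, rfl⟩
    exact (hD hp.1).2
  have hψle : ∀ a, ψ a ≤ β := fun a => by
    rw [← hDβ]
    exact sSup_le_sSup (Set.image_mono fun _ h => h.1)
  have hψc : ψ c = β := by
    rw [← hDβ]
    exact congrArg (fun s => sSup (Prod.snd '' s)) (Set.sep_eq_self_iff_mem_true.2 hcD)
  have hψanti : Antitone ψ := fun a a' h =>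
    sSup_le_sSup (Set.image_mono fun _ hp => ⟨hp.1, h.trans hp.2⟩)
  set K : Set L := {a ∈ A | ψ a = β} with hK
  have hKA : K ⊆ A := fun _ h => h.1
  have hca : c ≤ sSup K := le_sSup ⟨hc, hψc⟩
  set D' : Set (L × L) := {p ∈ D | ψ p.1 < β} with hD'
  set x' := ⨆ p ∈ D', p.1 ⊓ p.2 with hx'
  have hx'β : x' ≤ β := iSup₂_le fun p hp =>
    inf_le_right.trans (hDβ ▸ le_sSup ⟨p, hp.1, rfl⟩)
  have key : ⨆ p ∈ D, p.1 ⊓ p.2 = (β ⊓ sSup K) ⊔ x' := by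
    apply le_antisymm
    · refine iSup₂_le fun p hp => ?_
      by_cases h : ψ p.1 = β
      · refine le_sup_of_le_left (le_inf ?_ ?_)
        · exact inf_le_right.trans (hDβ ▸ le_sSup ⟨p, hp, rfl⟩)
        · exact inf_le_left.trans (le_sSup ⟨(hD hp).1, h⟩)
      · exact le_sup_of_le_right (le_iSup₂_of_le p ⟨hp, (hψle _).lt_of_ne h⟩ le_rfl)
    · refine sup_le ?_ (iSup₂_le fun p hp => le_iSup₂_of_le p hp.1 le_rfl)
      rw [hAuc β K hKA]
      refine iSup₂_le fun a ha => ?_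
      rw [← ha.2, inf_comm, hBuc a _ (hψB a)]
      refine iSup₂_le ?_
      rintro _ ⟨p, hp, rfl⟩
      exact le_iSup₂_of_le p hp.1 (inf_le_inf_right _ hp.2)
  have hmod : c ⊔ ((β ⊓ sSup K) ⊔ x') = (c ⊔ β) ⊓ (sSup K ⊔ x') := by
    rw [sup_inf_assoc_of_le β (hca.trans le_sup_left), inf_comm β, sup_comm, inf_comm β,
      sup_comm (sSup K) x', sup_inf_assoc_of_le (sSup K) hx'β, sup_comm c, sup_comm x']
  rw [key, hmod]
  refine inf_mem_infSpan (subset_infSpan _ ⟨c, hc, β, hβ, rfl⟩) ?_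
  obtain hemp | hne := D'.eq_empty_or_nonempty
  · have : x' = ⊥ := by simp [hx', hemp]
    rw [this]
    exact subset_infSpan _ ⟨sSup K, hAsup K hKA, ⊥, hbot, rfl⟩
  have hsub : Prod.snd '' D' ⊆ B := by
    rintro _ ⟨p, hp, rfl⟩
    exact (hD hp.1).2
  refine ih _ (hBsup _ hsub) ?_ D' (fun _ h => hD h.1) rfl _ (hAsup K hKA) ?_
  · obtain ⟨a, ⟨p, hp, rfl⟩, hmin⟩ := hA (Prod.fst '' D')
      (by rintro _ ⟨q, hq, rfl⟩; exact (hD hq.1).1) (hne.image _)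
    refine lt_of_le_of_lt (sSup_le_sSup ?_) hp.2
    exact Set.image_mono fun q hq => ⟨hq.1, hmin _ ⟨q, hq, rfl⟩⟩
  · refine fun p hp => sSup_le fun a ha => (hA.le_total ha.1 (hD hp.1).1).resolve_right fun h => ?_
    exact (ha.2 ▸ hψanti h).not_gt hp.2

theorem supSpan_subset_infSpan [IsModularLattice L] (hA : WellOrdered A) (hB : WellOrdered B)
    (hAsup : ∀ T ⊆ A, sSup T ∈ A) (hBsup : ∀ T ⊆ B, sSup T ∈ B)
    (hAuc : ∀ (x : L), ∀ T ⊆ A, x ⊓ sSup T = ⨆ t ∈ T, x ⊓ t)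
    (hBuc : ∀ (x : L), ∀ T ⊆ B, x ⊓ sSup T = ⨆ t ∈ T, x ⊓ t) :
    supSpan (Set.image2 (· ⊓ ·) A B) ⊆ infSpan (Set.image2 (· ⊔ ·) A B) := by
  rintro _ ⟨T, hT, rfl⟩
  have hsub : Prod.snd '' {p ∈ A ×ˢ B | p.1 ⊓ p.2 ∈ T} ⊆ B := by
    rintro _ ⟨p, hp, rfl⟩
    exact hp.1.2
  have hbot : (⊥ : L) ∈ A := by simpa using hAsup ∅ (Set.empty_subset _)
  have h := sup_iSup_mem_infSpan hA hB hAsup hBsup hAuc hBuc _ (hBsup _ hsub)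
    {p ∈ A ×ˢ B | p.1 ⊓ p.2 ∈ T} (fun _ h => h.1) rfl ⊥ hbot fun _ _ => bot_le
  convert h using 1
  rw [bot_sup_eq]
  apply le_antisymm
  · refine sSup_le fun t ht => ?_
    obtain ⟨a, ha, b, hb, rfl⟩ := hT ht
    exact le_iSup₂_of_le (a, b) ⟨⟨ha, hb⟩, ht⟩ le_rfl
  · exact iSup₂_le fun p hp => le_sSup hp.2

/-- The elements that are completely join-prime with respect to suprema of subsets of `S`. -/
def completePrimes (S : Set L) : Set L :=
  {p | ∀ T ⊆ S, p ≤ sSup T → ∃ t ∈ T, p ≤ t}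

theorem iInf_iSup_eq_of_le_sSup_completePrimes {S : Set L}
    (hsup : ∀ T ⊆ S, sSup T ∈ S) (hinf : ∀ T ⊆ S, sInf T ∈ S)
    (hprime : ∀ x ∈ S, x ≤ sSup {p ∈ completePrimes S | p ≤ x})
    {ι : Type u} {κ : ι → Type w} (f : ∀ i, κ i → L) (hf : ∀ i j, f i j ∈ S) :
    ⨅ i, ⨆ j, f i j = ⨆ g : ∀ i, κ i, ⨅ i, f i (g i) := by
  apply le_antisymm
  · have hmem : ⨅ i, ⨆ j, f i j ∈ S := by
      refine hinf _ ?_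
      rintro _ ⟨i, rfl⟩
      refine hsup _ ?_
      rintro _ ⟨j, rfl⟩
      exact hf i j
    refine (hprime _ hmem).trans (sSup_le fun p hp => ?_)
    have hex : ∀ i, ∃ j, p ≤ f i j := fun i => by
      obtain ⟨_, ⟨j, rfl⟩, hj⟩ := hp.1 (Set.range (f i))
        (by rintro _ ⟨j, rfl⟩; exact hf i j) (hp.2.trans (iInf_le _ i))
      exact ⟨j, hj⟩
    choose g hg using hex
    exact le_iSup_of_le g (le_iInf hg)
  · exact iSup_le fun g => le_iInf fun i => (iInf_le _ i).trans (le_iSup (f i) (g i))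

theorem inf_le_sSup_completePrimes [IsModularLattice L] (hA : WellOrdered A) (hB : WellOrdered B)
    (hAuc : ∀ (x : L), ∀ T ⊆ A, x ⊓ sSup T = ⨆ t ∈ T, x ⊓ t)
    (hBuc : ∀ (x : L), ∀ T ⊆ B, x ⊓ sSup T = ⨆ t ∈ T, x ⊓ t) :
    ∀ a ∈ A, ∀ b ∈ B,
      a ⊓ b ≤ sSup {p ∈ completePrimes (supSpan (Set.image2 (· ⊓ ·) A B)) | p ≤ a ⊓ b} := by
  refine hA.induction fun a ha iha => hB.induction fun b hb ihb => ?_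
  set a' := sSup {c ∈ A | c < a}
  set b' := sSup {c ∈ B | c < b}
  by_cases h : a ⊓ b ≤ a' ⊔ b'
  · have ha' : a' ≤ a := sSup_le fun _ h => h.2.le
    have hle : a ⊓ b ≤ (b ⊓ a') ⊔ (a ⊓ b') := by
      calc a ⊓ b ≤ ((a' ⊔ b') ⊓ a) ⊓ b := le_inf (le_inf h inf_le_left) inf_le_right
        _ = (a ⊓ b' ⊔ a') ⊓ b := by
          rw [sup_inf_assoc_of_le b' ha', inf_comm b', sup_comm]
        _ = (b ⊓ a') ⊔ (a ⊓ b') := by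
          rw [sup_inf_assoc_of_le a' (inf_le_right.trans (sSup_le fun _ h => h.2.le)),
            inf_comm a', sup_comm]
    refine hle.trans (sup_le ?_ ?_)
    · rw [hAuc b _ fun _ h => h.1]
      refine iSup₂_le fun c hc => ?_
      rw [inf_comm]
      exact (iha c hc.1 hc.2 b hb).trans
        (sSup_le_sSup fun p hp => ⟨hp.1, hp.2.trans (inf_le_inf_right _ hc.2.le)⟩)
    · rw [hBuc a _ fun _ h => h.1]
      refine iSup₂_le fun c hc => (ihb c hc.1 hc.2).trans ?_
      exact sSup_le_sSup fun p hp => ⟨hp.1, hp.2.trans (inf_le_inf_left _ hc.2.le)⟩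
  · refine le_sSup ⟨fun T hT hle => ?_, le_rfl⟩
    by_contra! hno
    refine h (hle.trans (sSup_le fun t ht => ?_))
    obtain ⟨U, hU, rfl⟩ := hT ht
    refine sSup_le fun g hg => ?_
    obtain ⟨c, hc, d, hd, rfl⟩ := hU hg
    by_cases hac : a ≤ c
    · have hbd : ¬ b ≤ d := fun hbd => hno _ ht ((inf_le_inf hac hbd).trans (le_sSup hg))
      exact le_sup_of_le_right
        (inf_le_right.trans (le_sSup ⟨hd, hB.lt_of_not_le hb hd hbd⟩))
    · exact le_sup_of_le_left
        (inf_le_left.trans (le_sSup ⟨hc, hA.lt_of_not_le ha hc hac⟩))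

theorem le_sSup_completePrimes {S G : Set L}
    (hG : ∀ g ∈ G, g ≤ sSup {p ∈ completePrimes S | p ≤ g}) :
    ∀ x ∈ supSpan G, x ≤ sSup {p ∈ completePrimes S | p ≤ x} := by
  rintro _ ⟨T, hT, rfl⟩
  exact sSup_le fun g hg => (hG g (hT hg)).trans
    (sSup_le_sSup fun p hp => ⟨hp.1, hp.2.trans (le_sSup hg)⟩)

end WellOrderedChains

open WellOrderedChains in
/-- **Saecular persistence, Theorem (well-ordered bifiltration extension).**
Every pair of well-ordered chains in a complete, modular, upper continuous lattice
extends to a sup/inf-closed, completely distributive subset. -/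
theorem wellOrdered_chains_extend_to_completelyDistributive_sublattice
    {L : Type*} [CompleteLattice L]
    (hmod : ∀ a b c : L, a ≤ c → a ⊔ (b ⊓ c) = (a ⊔ b) ⊓ c)
    (hUC : ∀ (a : L) (D : Set L), D.Nonempty → DirectedOn (· ≤ ·) D →
      a ⊓ sSup D = ⨆ d ∈ D, a ⊓ d)
    (C₁ C₂ : Set L)
    (hchain₁ : IsChain (· ≤ ·) C₁) (hchain₂ : IsChain (· ≤ ·) C₂)
    (hwo₁ : ∀ T ⊆ C₁, T.Nonempty → ∃ m ∈ T, ∀ x ∈ T, m ≤ x)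
    (hwo₂ : ∀ T ⊆ C₂, T.Nonempty → ∃ m ∈ T, ∀ x ∈ T, m ≤ x) :
    ∃ S : Set L, C₁ ∪ C₂ ⊆ S ∧
      (∀ T ⊆ S, sSup T ∈ S ∧ sInf T ∈ S) ∧
      (∀ (ι : Type u) (κ : ι → Type w) (f : ∀ i, κ i → L),
        (∀ i j, f i j ∈ S) →
        ⨅ i, ⨆ j, f i j = ⨆ g : ∀ i, κ i, ⨅ i, f i (g i)) := by
  have : IsModularLattice L := ⟨fun {x} y {z} h => (hmod x y z h).ge⟩
  have huc : ∀ A : Set L, WellOrdered A → ∀ (x : L), ∀ T ⊆ A, x ⊓ sSup T = ⨆ t ∈ T, x ⊓ t := by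
    intro A hA x T hT
    obtain rfl | hne := T.eq_empty_or_nonempty
    · simp
    refine hUC x T hne fun y hy z hz => ?_
    rcases hA.le_total (hT hy) (hT hz) with h | h
    · exact ⟨z, hz, h, le_rfl⟩
    · exact ⟨y, hy, le_rfl, h⟩
  set A : Set L := supSpan (insert ⊤ C₁)
  set B : Set L := supSpan (insert ⊤ C₂)
  have hA : WellOrdered A := (WellOrdered.insert_top hwo₁).supSpan
  have hB : WellOrdered B := (WellOrdered.insert_top hwo₂).supSpan
  have hAtop : ⊤ ∈ A := subset_supSpan _ (Set.mem_insert _ _)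
  have hBtop : ⊤ ∈ B := subset_supSpan _ (Set.mem_insert _ _)
  have hS : supSpan (Set.image2 (· ⊓ ·) A B) = infSpan (Set.image2 (· ⊔ ·) A B) :=
    (supSpan_subset_infSpan hA hB (fun _ => sSup_mem_supSpan) (fun _ => sSup_mem_supSpan)
      (huc A hA) (huc B hB)).antisymm (infSpan_subset_supSpan hA hB hAtop hBtop)
  have hsup : ∀ T ⊆ supSpan (Set.image2 (· ⊓ ·) A B),
      sSup T ∈ supSpan (Set.image2 (· ⊓ ·) A B) := fun _ => sSup_mem_supSpan
  have hinf : ∀ T ⊆ supSpan (Set.image2 (· ⊓ ·) A B),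
      sInf T ∈ supSpan (Set.image2 (· ⊓ ·) A B) := by
    rw [hS]
    exact fun _ => sInf_mem_infSpan
  refine ⟨supSpan (Set.image2 (· ⊓ ·) A B), ?_, fun T hT => ⟨hsup T hT, hinf T hT⟩, ?_⟩
  · rintro x (hx | hx)
    · exact subset_supSpan _
        ⟨x, subset_supSpan _ (Set.mem_insert_of_mem _ hx), ⊤, hBtop, inf_top_eq x⟩
    · exact subset_supSpan _
        ⟨⊤, hAtop, x, subset_supSpan _ (Set.mem_insert_of_mem _ hx), top_inf_eq x⟩
  · intro ι κ f hf
    refine iInf_iSup_eq_of_le_sSup_completePrimes hsup hinf (le_sSup_completePrimes ?_) f hf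
    rintro _ ⟨a, ha, b, hb, rfl⟩
    exact inf_le_sSup_completePrimes hA hB (huc A hA) (huc B hB) a ha b hb
end

section
/- Let G be a group, I and J linearly ordered sets, β : I → Subgroup G a monotone family of subgroups, and ν : J → Subgroup G a monotone family of subgroups such that ν j is a normal subgroup of G for every j. Then there exists a set S ⊆ Subgroup G containing every β i and every ν j, closed under pairwise ⊓ and ⊔ (a sublattice of the subgroup lattice of G), such that the distributive law a ⊓ (b ⊔ c) = (a ⊓ b) ⊔ (a ⊓ c) holds for all a, b, c ∈ S. -/
namespace Subgroup

open scoped FinsetFamily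

variable {G : Type*} [Group G] {I J : Type*}

/-- The subgroup generated by the intersections `β i ⊓ ν j` for `(i, j)` in a finite set. -/
def supInf (β : I → Subgroup G) (ν : J → Subgroup G) (F : Finset (I × J)) : Subgroup G :=
  F.sup fun p => β p.1 ⊓ ν p.2

theorem supInf_union [DecidableEq (I × J)] (β : I → Subgroup G) (ν : J → Subgroup G)
    (E F : Finset (I × J)) : supInf β ν (E ∪ F) = supInf β ν E ⊔ supInf β ν F :=
  Finset.sup_union

theorem supInf_le_sup [LinearOrder I] [LinearOrder J] {β : I → Subgroup G}
    {ν : J → Subgroup G} (hβ : Monotone β) (hν : Monotone ν) {F : Finset (I × J)} {i : I} {j : J}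
    (h : ∀ p ∈ F, p.1 ≤ i ∨ p.2 ≤ j) : supInf β ν F ≤ β i ⊔ ν j := by
  refine Finset.sup_le fun p hp => ?_
  rcases h p hp with h | h
  · exact inf_le_left.trans ((hβ h).trans le_sup_left)
  · exact inf_le_right.trans ((hν h).trans le_sup_right)

/-- When the `ν j` are normal, an element lies in `supInf β ν F` as soon as it lies in every
`β i ⊔ ν j` for which `(i, j)` dominates each point of `F` in some coordinate. -/
theorem mem_supInf_of_forall_mem_sup [LinearOrder I] [LinearOrder J] [OrderBot I] [OrderBot J]
    {β : I → Subgroup G} {ν : J → Subgroup G} (hβ : Monotone β) (hν : Monotone ν)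
    (hνnorm : ∀ j, (ν j).Normal) (hβbot : β ⊥ = ⊥) (hνbot : ν ⊥ = ⊥) (F : Finset (I × J)) {x : G}
    (hx : ∀ i j, (∀ p ∈ F, p.1 ≤ i ∨ p.2 ≤ j) → x ∈ β i ⊔ ν j) : x ∈ supInf β ν F := by
  classical
  induction F using Finset.strongInduction generalizing x with
  | H F ih =>
  rcases F.eq_empty_or_nonempty with rfl | hne
  · simpa [supInf, hβbot, hνbot] using hx ⊥ ⊥ (by simp)
  obtain ⟨p, hp, hmax⟩ := F.exists_max_image Prod.fst hne
  by_cases hred : ∃ q ∈ F.erase p, q.2 ≤ p.2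
  · obtain ⟨q, hq, hqp⟩ := hred
    obtain ⟨hqne, hqF⟩ := Finset.mem_erase.1 hq
    refine SetLike.le_def.1 (Finset.sup_mono (F.erase_subset q))
      (ih _ (Finset.erase_ssubset hqF) ?_)
    intro i j hij
    refine hx i j fun r hr => ?_
    by_cases hrq : r = q
    · subst hrq
      exact (hij p (Finset.mem_erase.2 ⟨hqne.symm, hp⟩)).imp (hmax r hr).trans hqp.trans
    · exact hij r (Finset.mem_erase.2 ⟨hrq, hr⟩)
  · push Not at hred
    set c := (F.erase p).sup Prod.fst
    have hcp : c ≤ p.1 := Finset.sup_le fun q hq => hmax q (Finset.mem_of_mem_erase hq)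
    have hxp : x ∈ β p.1 := by
      simpa [hνbot] using hx p.1 ⊥ fun q hq => Or.inl (hmax q hq)
    have hxc : x ∈ β c ⊔ ν p.2 := by
      refine hx c p.2 fun q hq => ?_
      by_cases hqp : q = p
      · exact Or.inr hqp.le.2
      · exact Or.inl (Finset.le_sup (f := Prod.fst) (Finset.mem_erase.2 ⟨hqp, hq⟩))
    have := hνnorm p.2
    obtain ⟨y, hy, z, hz, rfl⟩ := mem_sup_of_normal_right.1 hxc
    have hzp : z ∈ β p.1 := (mul_mem_cancel_left (hβ hcp hy)).1 hxp
    refine mul_mem ?_ (Finset.le_sup (f := fun p : I × J => β p.1 ⊓ ν p.2) hp ⟨hzp, hz⟩)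
    refine SetLike.le_def.1 (Finset.sup_mono (F.erase_subset p))
      (ih _ (Finset.erase_ssubset hp) ?_)
    intro i j hij
    rcases le_or_gt c i with hci | hic
    · exact mem_sup_left (hβ hci hy)
    obtain ⟨q, hq, hiq⟩ := Finset.lt_sup_iff.1 hic
    have hpj : p.2 ≤ j := (hred q hq).le.trans ((hij q hq).resolve_left hiq.not_ge)
    refine (mul_mem_cancel_right (mem_sup_right (hν hpj hz))).1 (hx i j fun r hr => ?_)
    by_cases hrp : r = p
    · exact Or.inr (hrp ▸ hpj)
    · exact hij r (Finset.mem_erase.2 ⟨hrp, hr⟩)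

theorem supInf_infs [DecidableEq (I × J)] [LinearOrder I] [LinearOrder J] [OrderBot I]
    [OrderBot J] {β : I → Subgroup G} {ν : J → Subgroup G} (hβ : Monotone β) (hν : Monotone ν)
    (hνnorm : ∀ j, (ν j).Normal) (hβbot : β ⊥ = ⊥) (hνbot : ν ⊥ = ⊥) (E F : Finset (I × J)) :
    supInf β ν (E ⊼ F) = supInf β ν E ⊓ supInf β ν F := by
  apply le_antisymm
  · refine Finset.sup_le fun r hr => ?_
    obtain ⟨p, hp, q, hq, rfl⟩ := Finset.mem_infs.1 hr
    refine le_inf (le_trans ?_ (Finset.le_sup (f := fun p : I × J => β p.1 ⊓ ν p.2) hp))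
      (le_trans ?_ (Finset.le_sup (f := fun p : I × J => β p.1 ⊓ ν p.2) hq))
    · exact inf_le_inf (hβ inf_le_left) (hν inf_le_left)
    · exact inf_le_inf (hβ inf_le_right) (hν inf_le_right)
  · rintro x ⟨hxE, hxF⟩
    refine mem_supInf_of_forall_mem_sup hβ hν hνnorm hβbot hνbot _ fun i j hij => ?_
    by_cases hE : ∀ p ∈ E, p.1 ≤ i ∨ p.2 ≤ j
    · exact supInf_le_sup hβ hν hE hxE
    refine supInf_le_sup hβ hν (fun q hq => ?_) hxF
    push Not at hE
    obtain ⟨p, hp, hpi, hpj⟩ := hE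
    have := hij _ (Finset.inf_mem_infs hp hq)
    simpa [hpi.not_ge, hpj.not_ge] using this

/-- The extension of a family of subgroups by `⊥` at the bottom and `⊤` at the top. -/
def extendBotTop (f : I → Subgroup G) : WithBot (WithTop I) → Subgroup G :=
  WithBot.recBotCoe ⊥ (WithTop.recTopCoe ⊤ f)

theorem monotone_extendBotTop [LinearOrder I] {f : I → Subgroup G} (hf : Monotone f) :
    Monotone (extendBotTop f) :=
  WithBot.monotone_iff.2 ⟨WithTop.monotone_iff.2 ⟨hf, fun _ => le_top⟩, fun _ => bot_le⟩

theorem normal_extendBotTop {f : I → Subgroup G} (hf : ∀ i, (f i).Normal) :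
    ∀ i, (extendBotTop f i).Normal
  | ⊥ => (inferInstance : (⊥ : Subgroup G).Normal)
  | ((⊤ : WithTop I) : WithBot (WithTop I)) => (inferInstance : (⊤ : Subgroup G).Normal)
  | ((i : I) : WithTop I) => hf i

end Subgroup

/-- **Half-normal bifiltrations generate a distributive sublattice of the subgroup lattice.**
Given a monotone family of subgroups and a monotone family of normal subgroups of a group `G`,
there is a sublattice of `Subgroup G` containing both families on which the distributive law
holds. -/
theorem halfNormal_bifiltration_extends_to_distributive_sublattice
    {G : Type*} [Group G] {I J : Type*} [LinearOrder I] [LinearOrder J]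
    (β : I → Subgroup G) (ν : J → Subgroup G)
    (hβ : Monotone β) (hν : Monotone ν) (hνnorm : ∀ j, (ν j).Normal) :
    ∃ S : Set (Subgroup G),
      (∀ i, β i ∈ S) ∧ (∀ j, ν j ∈ S) ∧
      (∀ a ∈ S, ∀ b ∈ S, a ⊓ b ∈ S ∧ a ⊔ b ∈ S) ∧
      (∀ a ∈ S, ∀ b ∈ S, ∀ c ∈ S, a ⊓ (b ⊔ c) = (a ⊓ b) ⊔ (a ⊓ c)) := by
  classical
  set β' := Subgroup.extendBotTop β
  set ν' := Subgroup.extendBotTop ν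
  have inf_eq := Subgroup.supInf_infs (Subgroup.monotone_extendBotTop hβ)
    (Subgroup.monotone_extendBotTop hν) (Subgroup.normal_extendBotTop hνnorm) rfl rfl
  refine ⟨Set.range (Subgroup.supInf β' ν'),
    fun i => ⟨{(((i : WithTop I) : WithBot (WithTop I)), ⊤)}, ?_⟩,
    fun j => ⟨{(⊤, ((j : WithTop J) : WithBot (WithTop J)))}, ?_⟩, ?_, ?_⟩
  · exact (Finset.sup_singleton ..).trans (inf_top_eq _)
  · exact (Finset.sup_singleton ..).trans (top_inf_eq _)
  · rintro _ ⟨E, rfl⟩ _ ⟨F, rfl⟩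
    exact ⟨⟨_, inf_eq E F⟩, ⟨E ∪ F, Subgroup.supInf_union β' ν' E F⟩⟩
  · rintro _ ⟨D, rfl⟩ _ ⟨E, rfl⟩ _ ⟨F, rfl⟩
    rw [← Subgroup.supInf_union, ← inf_eq, ← inf_eq, ← inf_eq, ← Subgroup.supInf_union,
      Finset.infs_union_right]
end

section
/- Let T be a linearly ordered set, k a field, and F a persistence module over T with coefficients in k such that F t is finite-dimensional for every t ∈ T. Then there exists an index type J and a family N : J → Π t, Submodule k (F t) such that: (i) each N j is a subfunctor of F; (ii) for every t ∈ T, the family (N j t)_{j ∈ J} is an internal direct sum decomposition of F t (the canonical map ⨁_j N j t → F t is bijective); (iii) each N j is an interval subfunctor of F. -/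
universe u v w

/-- A persistence module over a linearly ordered set `T` with coefficients in a field `k`:
a functor from the poset category of `T` to `k`-vector spaces. -/
structure PersistenceModule (T : Type u) [LinearOrder T] (k : Type v) [Field k] where
  V : T → Type w
  [addCommGroup : ∀ t, AddCommGroup (V t)]
  [module : ∀ t, Module k (V t)]
  map : ∀ {s t : T}, s ≤ t → V s →ₗ[k] V t
  map_refl : ∀ t : T, map (le_refl t) = LinearMap.id
  map_trans : ∀ {s t u : T} (hst : s ≤ t) (htu : t ≤ u),
    (map htu).comp (map hst) = map (hst.trans htu)

attribute [instance] PersistenceModule.addCommGroup PersistenceModule.module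

variable {T : Type u} [LinearOrder T] {k : Type v} [Field k]

/-- A family of submodules `N t ≤ F t` is a subfunctor of `F` if the structure maps of `F`
carry `N s` into `N t` for all `s ≤ t`. -/
def PersistenceModule.IsSubfunctor (F : PersistenceModule T k)
    (N : ∀ t, Submodule k (F.V t)) : Prop :=
  ∀ ⦃s t : T⦄ (h : s ≤ t), (N s).map (F.map h) ≤ N t

/-- A subfunctor is an interval subfunctor if its support is an interval and the structure
maps restrict to bijections between the fibers over the support. -/
def PersistenceModule.IsIntervalSubfunctor (F : PersistenceModule T k)
    (N : ∀ t, Submodule k (F.V t)) : Prop :=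
  F.IsSubfunctor N ∧
  (∀ ⦃s u t : T⦄, N s ≠ ⊥ → N t ≠ ⊥ → s ≤ u → u ≤ t → N u ≠ ⊥) ∧
  (∀ ⦃s t : T⦄ (h : s ≤ t), N s ≠ ⊥ → N t ≠ ⊥ →
    Set.BijOn (F.map h) (N s : Set (F.V s)) (N t : Set (F.V t)))

namespace PersistenceModule

theorem map_map_apply (F : PersistenceModule T k) {s t u : T} (hst : s ≤ t) (htu : t ≤ u)
    (x : F.V s) : F.map htu (F.map hst x) = F.map (hst.trans htu) x :=
  LinearMap.congr_fun (F.map_trans hst htu) x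

@[simp]
theorem map_self_apply (F : PersistenceModule T k) {t : T} (h : t ≤ t) (x : F.V t) :
    F.map h x = x :=
  LinearMap.congr_fun (F.map_refl t) x

/-- If no structure map inside `U` kills the element `x : F t`, then there is a compatible family
of functionals over `U` whose value at `x` is `1`. -/
theorem exists_compatible_dual (F : PersistenceModule T k) (U : Set T) {t : T} (ht : t ∈ U)
    (x : F.V t) (hx : ∀ u ∈ U, ∀ h : t ≤ u, F.map h x ≠ 0) :
    ∃ φ : ∀ u : U, Module.Dual k (F.V u),
      (∀ (s u : U) (h : (s : T) ≤ u) (y : F.V s), φ u (F.map h y) = φ s y) ∧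
      φ ⟨t, ht⟩ x = 1 := by
  classical
  let f : ∀ i j : U, i ≤ j → F.V i →ₗ[k] F.V j := fun i j h => F.map h
  have : DirectedSystem (fun i : U => F.V i) (fun i j h => f i j h) :=
    { map_self := fun i y => F.map_self_apply _ y
      map_map := fun i j l hij hjl y => F.map_map_apply hij hjl y }
  let ι := Module.DirectLimit.of k U (fun i : U => F.V i) f
  have hne : ι ⟨t, ht⟩ x ≠ 0 := fun h0 => by
    obtain ⟨j, hj, hj0⟩ := Module.DirectLimit.of.zero_exact h0
    exact hx j j.2 hj hj0
  obtain ⟨g, hg⟩ : ∃ g : Module.Dual k (Module.DirectLimit (fun i : U => F.V i) f),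
      g (ι ⟨t, ht⟩ x) ≠ 0 := by
    by_contra! h
    exact hne ((Module.forall_dual_apply_eq_zero_iff k _).1 h)
  refine ⟨fun u => (g (ι ⟨t, ht⟩ x))⁻¹ • g ∘ₗ ι u, fun s u h y => ?_, ?_⟩
  · have : ι u (F.map h y) = ι s y := Module.DirectLimit.of_f (f := f) (hij := h)
    simp [this]
  · simp [hg]

/-- A functional on one term of a directed system which vanishes on the kernels of the transition
maps extends to a compatible family of functionals on the whole system. -/
theorem exists_compatible_dual_extension {ι : Type*} [Preorder ι] [IsDirectedOrder ι]
    {G : ι → Type*} [∀ i, AddCommGroup (G i)] [∀ i, Module k (G i)]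
    (f : ∀ i j, i ≤ j → G i →ₗ[k] G j) [DirectedSystem G fun i j h => f i j h]
    (i : ι) (φ : Module.Dual k (G i))
    (hφ : ∀ (j : ι) (h : i ≤ j), LinearMap.ker (f i j h) ≤ LinearMap.ker φ) :
    ∃ g : ∀ j, Module.Dual k (G j),
      (∀ (j l : ι) (h : j ≤ l) (y : G j), g l (f j l h y) = g j y) ∧ g i = φ := by
  classical
  obtain ⟨g, hg⟩ : φ ∈ LinearMap.range (Module.DirectLimit.of k ι G f i).dualMap := by
    rw [LinearMap.range_dualMap_eq_dualAnnihilator_ker, Submodule.mem_dualAnnihilator]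
    intro y hy
    obtain ⟨j, hj, hj0⟩ := Module.DirectLimit.of.zero_exact (LinearMap.mem_ker.1 hy)
    exact hφ j hj hj0
  exact ⟨fun j => g ∘ₗ Module.DirectLimit.of k ι G f j,
    fun j l h y => congrArg g Module.DirectLimit.of_f, hg⟩

/-- In a pointwise finite-dimensional persistence module, an element `x : F t` lying in the image
of every structure map inside `D` extends to a compatible family of elements over `D`. -/
theorem exists_compatible_lift (F : PersistenceModule T k)
    [∀ t, FiniteDimensional k (F.V t)] (D : Set T) {t : T} (ht : t ∈ D)
    (x : F.V t) (hx : ∀ s ∈ D, ∀ h : s ≤ t, x ∈ LinearMap.range (F.map h)) :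
    ∃ y : ∀ s : D, F.V s,
      (∀ (s u : D) (h : (s : T) ≤ u), F.map h (y s) = y u) ∧ y ⟨t, ht⟩ = x := by
  let f : ∀ i j : Dᵒᵈ, i ≤ j → Module.Dual k (F.V (OrderDual.ofDual i : D)) →ₗ[k]
      Module.Dual k (F.V (OrderDual.ofDual j : D)) := fun i j h =>
    (F.map (show ((OrderDual.ofDual j : D) : T) ≤ (OrderDual.ofDual i : D) from h)).dualMap
  have : DirectedSystem (fun i : Dᵒᵈ => Module.Dual k (F.V (OrderDual.ofDual i : D)))
      (fun i j h => f i j h) :=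
    { map_self := fun i φ => LinearMap.ext fun y => congrArg φ (F.map_self_apply _ y)
      map_map := fun i j l hij hjl φ =>
        LinearMap.ext fun y => congrArg φ (F.map_map_apply _ _ y) }
  obtain ⟨g, hg, hgt⟩ := exists_compatible_dual_extension f (OrderDual.toDual ⟨t, ht⟩)
    (Module.Dual.eval k (F.V t) x) fun j hj ψ hψ => by
      obtain ⟨z, hz⟩ := hx (OrderDual.ofDual j : D) (OrderDual.ofDual j).2 hj
      have h0 : ψ (F.map hj z) = 0 := LinearMap.congr_fun (LinearMap.mem_ker.1 hψ) z
      exact (congrArg ψ hz).symm.trans h0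
  have key : ∀ (s : D) (ψ : Module.Dual k (F.V s)),
      ψ ((Module.evalEquiv k (F.V s)).symm (g (OrderDual.toDual s))) =
        g (OrderDual.toDual s) ψ :=
    fun s ψ => Module.apply_evalEquiv_symm_apply k (F.V s) ψ _
  refine ⟨fun s => (Module.evalEquiv k (F.V s)).symm (g (OrderDual.toDual s)),
    fun s u h => ?_, ?_⟩
  · refine Module.eval_apply_injective k (LinearMap.ext fun ψ => ?_)
    exact (key s ((F.map h).dualMap ψ)).trans
      ((hg (OrderDual.toDual u) (OrderDual.toDual s) h ψ).trans (key u ψ).symm)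
  · refine Module.eval_apply_injective k (LinearMap.ext fun ψ => ?_)
    exact (key ⟨t, ht⟩ ψ).trans (LinearMap.congr_fun hgt ψ)

/-- A nonzero finite-dimensional fiber contains a nonzero element lying in every nonzero image of
a structure map into that fiber. -/
theorem exists_ne_zero_mem_range (F : PersistenceModule T k) (t : T)
    [FiniteDimensional k (F.V t)] [Nontrivial (F.V t)] :
    ∃ x : F.V t, x ≠ 0 ∧ ∀ (s : T) (h : s ≤ t), F.map h ≠ 0 → x ∈ LinearMap.range (F.map h) := by
  obtain ⟨I, ⟨s₀, h₀, hI, rfl⟩, hmin⟩ := wellFounded_lt.has_min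
    {I : Submodule k (F.V t) | ∃ (s : T) (h : s ≤ t), F.map h ≠ 0 ∧ I = LinearMap.range (F.map h)}
    ⟨_, t, le_rfl, by
      obtain ⟨y, hy⟩ := exists_ne (0 : F.V t)
      exact fun h => hy (by simpa using LinearMap.congr_fun h y), rfl⟩
  obtain ⟨y, hy⟩ : ∃ y, F.map h₀ y ≠ 0 := by
    by_contra! h
    exact hI (LinearMap.ext h)
  refine ⟨F.map h₀ y, hy, fun s h hs => ?_⟩
  rcases le_total s₀ s with hle | hle
  · exact ⟨F.map hle y, F.map_map_apply _ _ _⟩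
  · have hsub : LinearMap.range (F.map h) ≤ LinearMap.range (F.map h₀) := by
      rintro _ ⟨z, rfl⟩
      exact ⟨F.map hle z, F.map_map_apply _ _ _⟩
    rw [hsub.eq_of_not_lt (hmin _ ⟨s, h, hs, rfl⟩)]
    exact ⟨y, rfl⟩

theorem isSubfunctor_span_singleton (F : PersistenceModule T k) (x : ∀ t, F.V t)
    (hx : ∀ ⦃s t : T⦄ (h : s ≤ t), x s ≠ 0 → F.map h (x s) = x t) :
    F.IsSubfunctor fun t => k ∙ x t := by
  intro s t h
  rw [Submodule.map_span_le]
  rintro _ rfl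
  by_cases h0 : x s = 0
  · simp [h0]
  · rw [hx h h0]
    exact Submodule.mem_span_singleton_self _

theorem isIntervalSubfunctor_span_singleton (F : PersistenceModule T k) (x : ∀ t, F.V t)
    (hx : ∀ ⦃s t : T⦄ (h : s ≤ t), x s ≠ 0 → F.map h (x s) = x t) :
    F.IsIntervalSubfunctor fun t => k ∙ x t := by
  refine ⟨F.isSubfunctor_span_singleton x hx, fun s u t hs ht hsu hut => ?_,
    fun s t h hs ht => ⟨fun y hy => F.isSubfunctor_span_singleton x hx h ⟨y, hy, rfl⟩, ?_, ?_⟩⟩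
  · simp only [ne_eq, Submodule.span_singleton_eq_bot] at hs ht ⊢
    intro hu
    apply ht
    rw [← hx (hsu.trans hut) hs, ← F.map_map_apply hsu hut, hx hsu hs, hu, map_zero]
  all_goals
    simp only [ne_eq, Submodule.span_singleton_eq_bot] at hs ht
  · intro y hy z hz hyz
    obtain ⟨a, rfl⟩ := Submodule.mem_span_singleton.1 hy
    obtain ⟨b, rfl⟩ := Submodule.mem_span_singleton.1 hz
    simp only [map_smul, hx h hs] at hyz
    rw [smul_left_injective k ht hyz]
  · intro y hy
    obtain ⟨a, rfl⟩ := Submodule.mem_span_singleton.1 hy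
    exact ⟨a • x s, Submodule.smul_mem _ _ (Submodule.mem_span_singleton_self _),
      by rw [map_smul, hx h hs]⟩

/-- A nonzero pointwise finite-dimensional persistence module has a nonzero interval summand. -/
theorem exists_interval_summand (F : PersistenceModule T k)
    [∀ t, FiniteDimensional k (F.V t)] (t : T) [Nontrivial (F.V t)] :
    ∃ (x : ∀ t, F.V t) (L : ∀ t, Submodule k (F.V t)),
      (∀ ⦃s t : T⦄ (h : s ≤ t), x s ≠ 0 → F.map h (x s) = x t) ∧ x t ≠ 0 ∧
      F.IsSubfunctor L ∧ ∀ s, IsCompl (k ∙ x s) (L s) := by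
  classical
  obtain ⟨x₀, hx₀, hmem⟩ := F.exists_ne_zero_mem_range t
  let D : Set T := {s | ∀ h : s ≤ t, F.map h ≠ 0}
  have htD : t ∈ D := fun h h0 => hx₀ (by simpa using LinearMap.congr_fun h0 x₀)
  have hDup : ∀ ⦃s u : T⦄, s ≤ u → s ∈ D → u ∈ D := fun s u hsu hs hut h0 =>
    hs (hsu.trans hut) (by rw [← F.map_trans hsu hut, h0, LinearMap.zero_comp])
  let U : Set T := {u | ∀ h : t ≤ u, F.map h x₀ ≠ 0}
  have htU : t ∈ U := fun h => by simpa using hx₀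
  obtain ⟨y, hy, hyt⟩ := F.exists_compatible_lift D htD x₀ fun s hs h => hmem s h (hs h)
  obtain ⟨φ, hφ, hφt⟩ := F.exists_compatible_dual U htU x₀ fun u hu h => hu h
  let x : ∀ s, F.V s := fun s => if hs : s ∈ D then y ⟨s, hs⟩ else 0
  have hxD : ∀ s (hs : s ∈ D), x s = y ⟨s, hs⟩ := fun s hs => dif_pos hs
  have hxnD : ∀ s, s ∉ D → x s = 0 := fun s hs => dif_neg hs
  have hx : ∀ ⦃s u : T⦄ (h : s ≤ u), x s ≠ 0 → F.map h (x s) = x u := by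
    intro s u h hs
    have hsD : s ∈ D := by
      by_contra hn
      exact hs (hxnD s hn)
    rw [hxD s hsD, hxD u (hDup h hsD)]
    exact hy ⟨s, hsD⟩ ⟨u, hDup h hsD⟩ h
  have hxt : x t = x₀ := (hxD t htD).trans hyt
  have hxge : ∀ u (h : t ≤ u), x u = F.map h x₀ := fun u h => by
    rw [← hx h (hxt ▸ hx₀), hxt]
  have hU : ∀ u, x u ≠ 0 → u ∈ U := fun u hu h => hxge u h ▸ hu
  have hzero : ∀ (s : T) (hs : s ∈ U), s ≤ t → x s = 0 → φ ⟨s, hs⟩ = 0 := by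
    intro s hs hst h0
    have hsD : s ∉ D := fun hsD => hx₀ <| by
      have := hy ⟨s, hsD⟩ ⟨t, htD⟩ hst
      rw [← hyt, ← this, ← hxD s hsD, h0, map_zero]
    have hmap : F.map hst = 0 := by
      by_contra hn
      exact hsD fun _ => hn
    ext z
    rw [← hφ ⟨s, hs⟩ ⟨t, htU⟩ hst z, hmap]
    simp
  have hone : ∀ u (hu : x u ≠ 0), φ ⟨u, hU u hu⟩ (x u) = 1 := by
    intro u hu
    rcases le_total u t with hut | htu
    · rw [← hφ ⟨u, hU u hu⟩ ⟨t, htU⟩ hut, hx hut hu, hxt, hφt]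
    · rw [hxge u htu, hφ ⟨t, htU⟩ ⟨u, hU u hu⟩ htu, hφt]
  let L : ∀ s, Submodule k (F.V s) := fun s =>
    if hs : x s = 0 then ⊤ else LinearMap.ker (φ ⟨s, hU s hs⟩)
  refine ⟨x, L, hx, hxt ▸ hx₀, ?_, ?_⟩
  · rintro s u h _ ⟨z, hz, rfl⟩
    by_cases hu : x u = 0
    · simp [L, hu]
    have hsU : s ∈ U := fun hts h0 => hU u hu (hts.trans h) (by
      rw [← F.map_map_apply hts h, h0, map_zero])
    simp only [L, dif_neg hu, LinearMap.mem_ker]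
    rw [hφ ⟨s, hsU⟩ ⟨u, hU u hu⟩ h]
    by_cases hs : x s = 0
    · rcases le_total s t with hst | hts
      · rw [hzero s hsU hst hs, LinearMap.zero_apply]
      · exact absurd ((hxge s hts).symm.trans hs) (hsU hts)
    · simpa [L, hs] using hz
  · intro s
    by_cases hs : x s = 0
    · simpa [L, hs] using isCompl_bot_top
    · simp only [L, dif_neg hs]
      have h1 := hone s hs
      refine IsCompl.of_eq ?_ ?_
      · refine (Submodule.eq_bot_iff _).2 ?_
        rintro z ⟨hz, hz0⟩
        obtain ⟨a, rfl⟩ := Submodule.mem_span_singleton.1 hz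
        have : a = 0 := by simpa [h1] using hz0
        rw [this, zero_smul]
      · refine Submodule.eq_top_iff'.2 fun z => ?_
        refine Submodule.mem_sup.2 ⟨φ ⟨s, hU s hs⟩ z • x s,
          Submodule.smul_mem _ _ (Submodule.mem_span_singleton_self _),
          z - φ ⟨s, hU s hs⟩ z • x s, ?_, by abel⟩
        simp [h1]

/-- The persistence module given by the fibers of a subfunctor. -/
def restrict (F : PersistenceModule T k) (R : ∀ t, Submodule k (F.V t))
    (hR : F.IsSubfunctor R) : PersistenceModule T k where
  V t := R t
  map h := (F.map h).restrict fun x hx => hR h ⟨x, hx, rfl⟩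
  map_refl _ := LinearMap.ext fun x => Subtype.ext (F.map_self_apply le_rfl x.1)
  map_trans hst htu := LinearMap.ext fun x => Subtype.ext (F.map_map_apply hst htu x.1)

/-- A nonzero subfunctor splits off a nonzero interval subfunctor. -/
theorem IsSubfunctor.exists_interval_summand {F : PersistenceModule T k}
    [∀ t, FiniteDimensional k (F.V t)] {R : ∀ t, Submodule k (F.V t)} (hR : F.IsSubfunctor R)
    (hne : R ≠ ⊥) :
    ∃ N L : ∀ t, Submodule k (F.V t), F.IsIntervalSubfunctor N ∧ F.IsSubfunctor L ∧
      N ≠ ⊥ ∧ Disjoint N L ∧ N ⊔ L = R := by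
  obtain ⟨t, ht⟩ : ∃ t, R t ≠ ⊥ := by
    by_contra! h
    exact hne (funext h)
  let M := F.restrict R hR
  have : ∀ t, FiniteDimensional k (M.V t) := fun t =>
    inferInstanceAs (FiniteDimensional k (R t))
  have : Nontrivial (M.V t) := Submodule.nontrivial_iff_ne_bot.2 ht
  obtain ⟨x, L, hx, hxt, hL, hc⟩ := M.exists_interval_summand t
  let e : ∀ t, M.V t →ₗ[k] F.V t := fun t => (R t).subtype
  have he : ∀ t, Function.Injective (e t) := fun t => Subtype.val_injective
  have hspan : ∀ t, k ∙ e t (x t) = (k ∙ x t).map (e t) := fun t => by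
    rw [Submodule.map_span, Set.image_singleton]
  refine ⟨fun t => k ∙ e t (x t), fun t => (L t).map (e t),
    F.isIntervalSubfunctor_span_singleton _ fun s t h hs => ?_, ?_, fun h => ?_, ?_, ?_⟩
  · exact congrArg (e t) (hx h fun h0 => hs (by rw [h0, map_zero]))
  · rintro s t h _ ⟨_, ⟨z, hz, rfl⟩, rfl⟩
    exact ⟨M.map h z, hL h ⟨z, hz, rfl⟩, rfl⟩
  · have := congrFun h t
    simp only [Pi.bot_apply, Submodule.span_singleton_eq_bot] at this
    exact hxt (he t (this.trans (map_zero _).symm))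
  · refine Pi.disjoint_iff.2 fun s => ?_
    rw [hspan]
    exact (Submodule.disjoint_map (he s) (hc s).disjoint)
  · funext s
    rw [Pi.sup_apply, hspan, ← Submodule.map_sup, (hc s).sup_eq_top, Submodule.map_top]
    exact Submodule.range_subtype _

/-- `S` is an independent set of interval subfunctors of `F`, and the subfunctor `R` is a
complement of its sum. -/
structure IsPartialDecomposition (F : PersistenceModule T k)
    (S : Set (∀ t, Submodule k (F.V t))) (R : ∀ t, Submodule k (F.V t)) : Prop where
  interval : ∀ N ∈ S, F.IsIntervalSubfunctor N
  subfunctor : F.IsSubfunctor R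
  indep : sSupIndep S
  isCompl : IsCompl (sSup S) R

theorem isModularLattice_pi {ι : Type*} {α : ι → Type*} [∀ i, Lattice (α i)]
    [∀ i, IsModularLattice (α i)] : IsModularLattice (∀ i, α i) :=
  ⟨fun y _ h i => IsModularLattice.sup_inf_le_assoc_of_le (y i) (h i)⟩

theorem IsPartialDecomposition.insert {F : PersistenceModule T k}
    {S : Set (∀ t, Submodule k (F.V t))} {R N L : ∀ t, Submodule k (F.V t)}
    (h : F.IsPartialDecomposition S R) (hN : F.IsIntervalSubfunctor N) (hL : F.IsSubfunctor L)
    (hd : Disjoint N L) (hsup : N ⊔ L = R) : F.IsPartialDecomposition (insert N S) L := by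
  have : IsModularLattice (∀ t, Submodule k (F.V t)) := isModularLattice_pi
  subst hsup
  have hNS : Disjoint (sSup S) N := h.isCompl.disjoint.mono_right le_sup_left
  refine ⟨?_, hL, ?_, ?_, ?_⟩
  · rintro A (rfl | hA)
    exacts [hN, h.interval A hA]
  · rintro A (rfl | hA)
    · refine hNS.symm.mono_right (sSup_le_sSup ?_)
      rintro B ⟨rfl | hB, hBA⟩
      exacts [absurd rfl hBA, hB]
    · have h1 : Disjoint A (sSup (S \ {A}) ⊔ N) :=
        (h.indep hA).disjoint_sup_right_of_disjoint_sup_left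
          (hNS.mono_left (sup_le (le_sSup hA) (sSup_le_sSup Set.sdiff_subset)))
      refine h1.mono_right (sSup_le ?_)
      rintro B ⟨rfl | hB, hBA⟩
      exacts [le_sup_right, (le_sSup (show B ∈ S \ {A} from ⟨hB, hBA⟩)).trans le_sup_left]
  · rw [sSup_insert, sup_comm]
    exact (hd.symm.disjoint_sup_right_of_disjoint_sup_left
      (by rw [sup_comm]; exact h.isCompl.disjoint.symm)).symm.mono_left (by rw [sup_comm])
  · rw [codisjoint_iff, sSup_insert, sup_comm N, sup_assoc]
    exact h.isCompl.sup_eq_top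

theorem IsPartialDecomposition.sUnion_iInf {F : PersistenceModule T k}
    [∀ t, FiniteDimensional k (F.V t)]
    {c : Set (Set (∀ t, Submodule k (F.V t)) × (∀ t, Submodule k (F.V t))ᵒᵈ)}
    (hc : ∀ p ∈ c, F.IsPartialDecomposition p.1 (OrderDual.ofDual p.2))
    (hchain : IsChain (· ≤ ·) c) (hne : c.Nonempty) :
    F.IsPartialDecomposition (⋃ p ∈ c, p.1) (⨅ p ∈ c, OrderDual.ofDual p.2) := by
  have hstable : ∀ t, ∃ p ∈ c, (⨅ q ∈ c, OrderDual.ofDual q.2) t = (OrderDual.ofDual p.2) t ∧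
      ∀ N ∈ ⋃ q ∈ c, q.1, N ∉ p.1 → N t = ⊥ := by
    intro t
    obtain ⟨_, ⟨p, hp, rfl⟩, hmin⟩ := wellFounded_lt.has_min
      (Set.image (fun p : Set (∀ t, Submodule k (F.V t)) × (∀ t, Submodule k (F.V t))ᵒᵈ =>
        (OrderDual.ofDual p.2) t) c) (hne.image _)
    have heq : ∀ q ∈ c, p ≤ q → (OrderDual.ofDual q.2) t = (OrderDual.ofDual p.2) t :=
      fun q hq hpq => LE.le.eq_of_not_lt (hpq.2 t) (hmin _ ⟨q, hq, rfl⟩)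
    refine ⟨p, hp, ?_, fun N hN hNp => ?_⟩
    · simp only [iInf_apply]
      refine le_antisymm (iInf₂_le p hp) (le_iInf₂ fun q hq => ?_)
      rcases hchain.total hp hq with h | h
      · exact (heq q hq h).ge
      · exact h.2 t
    · simp only [Set.mem_iUnion, exists_prop] at hN
      obtain ⟨q, hq, hNq⟩ := hN
      rcases hchain.total hp hq with h | h
      · have hle : sSup p.1 ≤ sSup (q.1 \ {N}) :=
          sSup_le_sSup fun A hA => ⟨h.1 hA, fun hAN => hNp (hAN ▸ hA)⟩
        have hd : Disjoint (N t) (sSup p.1 t) :=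
          (Pi.disjoint_iff.1 ((hc q hq).indep hNq) t).mono_right (hle t)
        have hpt := Pi.isCompl_iff.1 (hc p hp).isCompl t
        have hqt := Pi.isCompl_iff.1 (hc q hq).isCompl t
        rw [heq q hq h] at hqt
        have hsup : sSup p.1 t = sSup q.1 t :=
          eq_of_le_of_inf_le_of_sup_le (z := (OrderDual.ofDual p.2) t) (sSup_le_sSup h.1 t)
            (by rw [hqt.inf_eq_bot]; exact bot_le) (by rw [hpt.sup_eq_top]; exact le_top)
        exact hd.eq_bot_of_le (hsup ▸ (le_sSup hNq : N ≤ sSup q.1) t)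
      · exact absurd (h.1 hNq) hNp
  refine ⟨fun N hN => ?_, fun s t h => ?_, fun N hN => ?_, ?_⟩
  · simp only [Set.mem_iUnion, exists_prop] at hN
    obtain ⟨p, hp, hNp⟩ := hN
    exact (hc p hp).interval N hNp
  · simp only [iInf_apply]
    exact le_iInf₂ fun p hp => (Submodule.map_mono (iInf₂_le p hp)).trans
      ((hc p hp).subfunctor h)
  · refine Pi.disjoint_iff.2 fun t => ?_
    obtain ⟨p, hp, -, hbot⟩ := hstable t
    by_cases hNp : N ∈ p.1
    · refine (Pi.disjoint_iff.1 ((hc p hp).indep hNp) t).mono_right ?_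
      rw [sSup_apply]
      refine iSup_le fun A => ?_
      by_cases hA : A.1 ∈ p.1
      · exact (le_sSup (show A.1 ∈ p.1 \ {N} from ⟨hA, A.2.2⟩) : A.1 ≤ _) t
      · rw [hbot A.1 A.2.1 hA]
        exact bot_le
    · rw [hbot N hN hNp]
      exact disjoint_bot_left
  · refine Pi.isCompl_iff.2 fun t => ?_
    obtain ⟨p, hp, hR, hbot⟩ := hstable t
    have hsup : sSup (⋃ p ∈ c, p.1) t = sSup p.1 t := by
      refine le_antisymm ?_ (sSup_le_sSup (Set.subset_biUnion_of_mem (u := Prod.fst) hp) t)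
      rw [sSup_apply]
      refine iSup_le fun A => ?_
      by_cases hA : A.1 ∈ p.1
      · exact (le_sSup hA : A.1 ≤ _) t
      · rw [hbot A.1 A.2 hA]
        exact bot_le
    rw [hR, hsup]
    exact Pi.isCompl_iff.1 (hc p hp).isCompl t

theorem exists_isPartialDecomposition_bot (F : PersistenceModule T k)
    [∀ t, FiniteDimensional k (F.V t)] :
    ∃ S : Set (∀ t, Submodule k (F.V t)), F.IsPartialDecomposition S ⊥ := by
  have htriv : F.IsPartialDecomposition ∅ ⊤ :=
    ⟨by simp, fun _ _ _ => le_top, sSupIndep_empty, by simpa using isCompl_bot_top⟩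
  obtain ⟨p, -, hp, hmax⟩ := zorn_le_nonempty₀
    {p : Set (∀ t, Submodule k (F.V t)) × (∀ t, Submodule k (F.V t))ᵒᵈ |
      F.IsPartialDecomposition p.1 (OrderDual.ofDual p.2)}
    (fun c hc hchain q hq => ⟨(⋃ p ∈ c, p.1, OrderDual.toDual (⨅ p ∈ c, OrderDual.ofDual p.2)),
      IsPartialDecomposition.sUnion_iInf hc hchain ⟨q, hq⟩,
      fun p hp => ⟨Set.subset_biUnion_of_mem (u := Prod.fst) hp,
        (iInf₂_le p hp : (⨅ p ∈ c, OrderDual.ofDual p.2) ≤ OrderDual.ofDual p.2)⟩⟩)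
    (∅, OrderDual.toDual ⊤) htriv
  refine ⟨p.1, ?_⟩
  suffices h : OrderDual.ofDual p.2 = ⊥ from h ▸ hp
  by_contra hne
  obtain ⟨N, L, hN, hL, hN0, hd, hsup⟩ := hp.subfunctor.exists_interval_summand hne
  have hle : L ≤ OrderDual.ofDual p.2 := hsup ▸ le_sup_right
  have hmem : N ∈ p.1 := (hmax (y := (insert N p.1, OrderDual.toDual L))
    (hp.insert hN hL hd hsup) ⟨Set.subset_insert _ _, hle⟩).1 (Set.mem_insert _ _)
  exact hN0 <| (hp.isCompl.disjoint.mono (le_sSup hmem) (hsup ▸ le_sup_left)).eq_bot_of_self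

theorem IsPartialDecomposition.diff_bot {F : PersistenceModule T k}
    {S : Set (∀ t, Submodule k (F.V t))} {R : ∀ t, Submodule k (F.V t)}
    (h : F.IsPartialDecomposition S R) : F.IsPartialDecomposition (S \ {⊥}) R :=
  ⟨fun N hN => h.interval N hN.1, h.subfunctor, h.indep.mono Set.sdiff_subset, by
    rw [sSup_sdiff_singleton_bot]
    exact h.isCompl⟩

theorem IsPartialDecomposition.iSupIndep_apply {F : PersistenceModule T k}
    {S : Set (∀ t, Submodule k (F.V t))} {R : ∀ t, Submodule k (F.V t)}
    (h : F.IsPartialDecomposition S R) (t : T) : iSupIndep fun N : S => N.1 t := by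
  intro N
  refine (Pi.disjoint_iff.1 (h.indep N.2) t).mono_right (iSup₂_le fun A hA => ?_)
  exact (le_sSup (show A.1 ∈ S \ {N.1} from ⟨A.2, fun h => hA (Subtype.ext h)⟩) : A.1 ≤ _) t

/-- Only finitely many summands are nonzero at each `t : T`, so an independent set of nonzero
summands is no larger than the universe of `T`, whatever the universe of the fibers. -/
theorem IsPartialDecomposition.small {F : PersistenceModule T k}
    [∀ t, FiniteDimensional k (F.V t)]
    {S : Set (∀ t, Submodule k (F.V t))} {R : ∀ t, Submodule k (F.V t)}
    (h : F.IsPartialDecomposition S R) (hbot : ⊥ ∉ S) : Small.{u} S := by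
  have hfin : ∀ t, Finite {N : S // N.1 t ≠ ⊥} := fun t =>
    (WellFoundedGT.finite_ne_bot_of_iSupIndep (h.iSupIndep_apply t)).to_subtype
  refine small_of_surjective (f := fun p : Σ t, {N : S // N.1 t ≠ ⊥} => p.2.1) fun N => ?_
  obtain ⟨t, ht⟩ : ∃ t, N.1 t ≠ ⊥ := by
    by_contra! h0
    exact hbot ((funext h0 : N.1 = ⊥) ▸ N.2)
  exact ⟨⟨t, N, ht⟩, rfl⟩

end PersistenceModule

/-- **Interval decomposition of pointwise finite-dimensional persistence modules.**
Every persistence module over a linearly ordered set with finite-dimensional fibers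
splits as an internal direct sum of interval subfunctors. -/
theorem PersistenceModule.exists_interval_decomposition_of_finiteDimensional
    (F : PersistenceModule T k) (hfd : ∀ t, FiniteDimensional k (F.V t)) :
    ∃ (J : Type (max u w)) (N : J → ∀ t, Submodule k (F.V t)),
      (∀ j, F.IsSubfunctor (N j)) ∧
      (∀ t, haveI := Classical.decEq J; DirectSum.IsInternal (fun j => N j t)) ∧
      (∀ j, F.IsIntervalSubfunctor (N j)) := by
  obtain ⟨S₀, hS₀⟩ := F.exists_isPartialDecomposition_bot
  obtain ⟨S, hS, hbot⟩ : ∃ S, F.IsPartialDecomposition S ⊥ ∧ ⊥ ∉ S :=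
    ⟨S₀ \ {⊥}, hS₀.diff_bot, fun h => h.2 rfl⟩
  have : Small.{u} S := hS.small hbot
  have : Small.{max u w} S := small_lift S
  let e : Shrink.{max u w} S ≃ S := (equivShrink S).symm
  refine ⟨Shrink.{max u w} S, fun j => (e j).1, fun j => (hS.interval _ (e j).2).1, fun t => ?_,
    fun j => hS.interval _ (e j).2⟩
  let _ := Classical.decEq (Shrink.{max u w} S)
  refine DirectSum.isInternal_submodule_of_iSupIndep_of_iSup_eq_top
    ((hS.iSupIndep_apply t).comp e.injective) ?_
  have htop : sSup S = ⊤ := by simpa using hS.isCompl.sup_eq_top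
  rw [e.iSup_comp (g := fun N : S => N.1 t), ← sSup_apply, htop, Pi.top_apply]
end

section
/- Let G be a group, r ≥ 1, H₁ ≥ H₂ ≥ ⋯ ≥ H_r a decreasing family of subgroups of G, and N₁ ≤ N₂ ≤ ⋯ ≤ N_r an increasing family of subgroups of G with each N_i normal in G. Then (H₁ ⊓ N₁) ⊔ (H₂ ⊓ N₂) ⊔ ⋯ ⊔ (H_r ⊓ N_r) = H₁ ⊓ (N₁ ⊔ H₂) ⊓ (N₂ ⊔ H₃) ⊓ ⋯ ⊓ (N_{r−1} ⊔ H_r) ⊓ N_r, and dually (N₁ ⊔ H₁) ⊓ (N₂ ⊔ H₂) ⊓ ⋯ ⊓ (N_r ⊔ H_r) = N₁ ⊔ (H₁ ⊓ N₂) ⊔ (H₂ ⊓ N₃) ⊔ ⋯ ⊔ (H_{r−1} ⊓ N_r) ⊔ H_r. -/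
/-- The nontrivial inequality in the transmutation of a join of meets into a meet of joins. -/
theorem halfNormal_meet_le_join {G : Type*} [Group G] (r : ℕ)
    (H N : Fin (r + 1) → Subgroup G) (hH : Antitone H) (hN : Monotone N)
    (hnorm : ∀ i, (N i).Normal) :
    H 0 ⊓ (⨅ i : Fin r, (N i.castSucc ⊔ H i.succ)) ⊓ N (Fin.last r) ≤ ⨆ i, H i ⊓ N i := by
  induction r with
  | zero => exact le_iSup_of_le 0 (by simp)
  | succ r ih =>
    intro x hmem
    simp only [Subgroup.mem_inf, Subgroup.mem_iInf] at hmem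
    obtain ⟨⟨hx0, hx⟩, hxl⟩ := hmem
    have := hnorm 0
    obtain ⟨n, hn, h, hh, rfl⟩ := Subgroup.mem_sup_of_normal_left.1 (hx 0)
    have hnN : ∀ i, n ∈ N i := fun i => hN (Fin.zero_le i) hn
    have hn0 : n ∈ H 0 := (Subgroup.mul_mem_cancel_right _ (hH (Fin.zero_le _) hh)).1 hx0
    refine mul_mem (le_iSup (fun i => H i ⊓ N i) 0 ⟨hn0, hn⟩) ?_
    have tail := ih (fun i => H i.succ) (fun i => N i.succ)
      (fun i j hij => hH (Fin.succ_le_succ_iff.2 hij))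
      (fun i j hij => hN (Fin.succ_le_succ_iff.2 hij)) (fun i => hnorm i.succ)
    refine iSup_le (fun i : Fin (r + 1) => le_iSup (fun i => H i ⊓ N i) i.succ)
      (tail (Subgroup.mem_inf.2 ⟨Subgroup.mem_inf.2 ⟨hh, Subgroup.mem_iInf.2 fun i => ?_⟩, ?_⟩))
    · exact (Subgroup.mul_mem_cancel_left _ (le_sup_left (a := N i.castSucc.succ) (hnN _))).1
        (hx i.succ)
    · exact (Subgroup.mul_mem_cancel_left _ (hnN _)).1 hxl

/-- **Transmutation of meets and joins for half-normal bifiltrations.**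
For a decreasing family `H` of subgroups and an increasing family `N` of normal subgroups
of `G` (indexed by `Fin (r+1)`, so the families have `r + 1 ≥ 1` members),
`(H₀ ⊓ N₀) ⊔ ⋯ ⊔ (H_r ⊓ N_r) = H₀ ⊓ (N₀ ⊔ H₁) ⊓ ⋯ ⊓ (N_{r-1} ⊔ H_r) ⊓ N_r` and dually
`(N₀ ⊔ H₀) ⊓ ⋯ ⊓ (N_r ⊔ H_r) = N₀ ⊔ (H₀ ⊓ N₁) ⊔ ⋯ ⊔ (H_{r-1} ⊓ N_r) ⊔ H_r`. -/
theorem transmute_meet_join_halfNormal {G : Type*} [Group G] (r : ℕ)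
    (H N : Fin (r + 1) → Subgroup G) (hH : Antitone H) (hN : Monotone N)
    (hnorm : ∀ i, (N i).Normal) :
    (⨆ i, H i ⊓ N i) =
      H 0 ⊓ (⨅ i : Fin r, (N i.castSucc ⊔ H i.succ)) ⊓ N (Fin.last r) ∧
    (⨅ i, N i ⊔ H i) =
      N 0 ⊔ (⨆ i : Fin r, (H i.castSucc ⊓ N i.succ)) ⊔ H (Fin.last r) := by
  constructor
  · refine le_antisymm (iSup_le fun i => ?_) (halfNormal_meet_le_join r H N hH hN hnorm)
    refine le_inf (le_inf (inf_le_left.trans (hH (Fin.zero_le i))) (le_iInf fun j => ?_))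
      (inf_le_right.trans (hN (Fin.le_last i)))
    rcases le_or_gt i j.castSucc with hij | hij
    · exact inf_le_right.trans ((hN hij).trans le_sup_left)
    · exact inf_le_left.trans ((hH (Fin.castSucc_lt_iff_succ_le.1 hij)).trans le_sup_right)
  · refine le_antisymm (fun x hx => ?_) (le_iInf fun j => ?_)
    · rw [Subgroup.mem_iInf] at hx
      have := hnorm 0
      obtain ⟨n, hn, h, hh, rfl⟩ := Subgroup.mem_sup_of_normal_left.1 (hx 0)
      rw [sup_assoc]
      refine Subgroup.mul_mem_sup hn ?_
      -- Shift `N` by one index, closing it up with the whole group.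
      let N' : Fin (r + 1) → Subgroup G := Fin.snoc (fun i : Fin r => N i.succ) ⊤
      have hN'c (i : Fin r) : N' i.castSucc = N i.succ := by simp [N']
      have hN'l : N' (Fin.last r) = ⊤ := by simp [N']
      have hN' : Monotone N' := by
        intro i j hij
        induction j using Fin.lastCases with
        | last => simp [hN'l]
        | cast j =>
          induction i using Fin.lastCases with
          | last => exact absurd hij (not_le.2 (Fin.castSucc_lt_last j))
          | cast i =>
            rw [hN'c, hN'c]
            exact hN (Fin.succ_le_succ_iff.2 (Fin.castSucc_le_castSucc_iff.1 hij))
      have hnorm' (i : Fin (r + 1)) : (N' i).Normal := by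
        induction i using Fin.lastCases with
        | last => rw [hN'l]; infer_instance
        | cast i => rw [hN'c]; exact hnorm _
      have hle : ⨆ i, H i ⊓ N' i ≤
          (⨆ i : Fin r, (H i.castSucc ⊓ N i.succ)) ⊔ H (Fin.last r) := by
        refine iSup_le fun i => ?_
        induction i using Fin.lastCases with
        | last => exact inf_le_left.trans le_sup_right
        | cast i =>
          rw [hN'c]
          exact le_sup_of_le_left (le_iSup (fun i : Fin r => H i.castSucc ⊓ N i.succ) i)
      refine hle (halfNormal_meet_le_join r H N' hH hN' hnorm'
        (Subgroup.mem_inf.2 ⟨Subgroup.mem_inf.2 ⟨hh, Subgroup.mem_iInf.2 fun i => ?_⟩, ?_⟩))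
      · rw [hN'c]
        exact (Subgroup.mul_mem_cancel_left _
          (le_sup_left (a := N i.succ) (hN (Fin.zero_le _) hn))).1 (hx i.succ)
      · simp [hN'l]
    · refine sup_le (sup_le ((hN (Fin.zero_le j)).trans le_sup_left) (iSup_le fun i => ?_))
        ((hH (Fin.le_last j)).trans le_sup_right)
      rcases le_or_gt j i.castSucc with hij | hij
      · exact inf_le_left.trans ((hH hij).trans le_sup_right)
      · exact inf_le_right.trans ((hN (Fin.castSucc_lt_iff_succ_le.1 hij)).trans le_sup_left)
end

section
/- Let Λ be a linearly ordered set, k a field, V a k-vector space, and Ω : LowerSet Λ → Submodule k V a complete lattice homomorphism (preserving arbitrary sSup and sInf; in particular Ω ⊥ = ⊥ and Ω ⊤ = ⊤). Suppose the image of Ω is well-ordered by ≤ (every nonempty subset of the image has a least element). For each a ∈ Λ, let B a be a prebasis of the quotient Ω(LowerSet.Iic a) / Ω(LowerSet.Iio a). Then the union ⋃_{a ∈ Λ} B a is linearly independent and spans V; that is, it is a basis of V. -/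
/-- `B` is a prebasis of the quotient `W / U`: `B ⊆ W`, the images of the elements of `B`
under the quotient map `V → V ⧸ U` are linearly independent (in particular distinct), and
they span the image of `W` in `V ⧸ U`. -/
def IsPrebasis {k V : Type*} [Field k] [AddCommGroup V] [Module k V]
    (U W : Submodule k V) (B : Set V) : Prop :=
  B ⊆ (W : Set V) ∧
  LinearIndependent k (fun b : B => U.mkQ (b : V)) ∧
  Submodule.span k (U.mkQ '' B) = W.map U.mkQ

section Prebasis

variable {k V : Type*} [Field k] [AddCommGroup V] [Module k V]

theorem IsPrebasis.linearIndepOn_id {U W : Submodule k V} {B : Set V} (h : IsPrebasis U W B) :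
    LinearIndepOn k id B :=
  LinearIndependent.of_comp U.mkQ h.2.1

theorem IsPrebasis.disjoint_span {U W : Submodule k V} {B : Set V} (h : IsPrebasis U W B) :
    Disjoint U (Submodule.span k B) := by
  simpa using (Submodule.range_ker_disjoint h.2.1).symm

theorem IsPrebasis.le_sup_span {U W : Submodule k V} {B : Set V} (h : IsPrebasis U W B) :
    W ≤ U ⊔ Submodule.span k B := by
  have h3 := h.2.2
  rw [← Submodule.map_span] at h3
  have h4 := congrArg (Submodule.comap U.mkQ) h3
  rw [Submodule.comap_map_mkQ, Submodule.comap_map_mkQ] at h4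
  rw [h4]
  exact le_sup_right

end Prebasis

section Filtration

variable {Λ : Type*} [LinearOrder Λ] {k V : Type*} [Field k] [AddCommGroup V] [Module k V]

theorem linearIndepOn_id_iUnion_of_isPrebasis {Ω : LowerSet Λ → Submodule k V} (hΩ : Monotone Ω)
    {B : Λ → Set V}
    (hB : ∀ a : Λ, IsPrebasis (Ω (LowerSet.Iio a)) (Ω (LowerSet.Iic a)) (B a)) :
    LinearIndepOn k id (⋃ a, B a) := by
  have key : ∀ s : Finset Λ, LinearIndepOn k id (⋃ a ∈ s, B a) := by
    intro s
    induction s using Finset.induction_on_max with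
    | empty => simp
    | insert a s hs ih =>
      rw [Finset.set_biUnion_insert, Set.union_comm]
      refine ih.id_union (hB a).linearIndepOn_id ((hB a).disjoint_span.mono_left ?_)
      refine Submodule.span_le.2 (Set.iUnion₂_subset fun b hb => (hB b).1.trans ?_)
      exact hΩ fun x hx => lt_of_le_of_lt hx (hs b hb)
  rw [Set.iUnion_eq_iUnion_finset]
  refine linearIndepOn_iUnion_of_directed (Monotone.directed_le fun s t hst => ?_) key
  exact Set.biUnion_subset_biUnion_left hst

theorem map_eq_iSup_map_Iic (Ω : CompleteLatticeHom (LowerSet Λ) (Submodule k V)) (L : LowerSet Λ) :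
    Ω L = ⨆ a ∈ L, Ω (LowerSet.Iic a) := by
  have hL : L = ⨆ a ∈ L, LowerSet.Iic a := by
    simpa using (LowerSet.iSup_Iic (L : Set Λ)).symm
  conv_lhs => rw [hL]
  simp only [map_iSup]

theorem span_iUnion_eq_top_of_isPrebasis (Ω : CompleteLatticeHom (LowerSet Λ) (Submodule k V))
    (hwo : ∀ S ⊆ Set.range (⇑Ω), S.Nonempty → ∃ m ∈ S, ∀ x ∈ S, m ≤ x) {B : Λ → Set V}
    (hB : ∀ a : Λ, IsPrebasis (Ω (LowerSet.Iio a)) (Ω (LowerSet.Iic a)) (B a)) :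
    Submodule.span k (⋃ a, B a) = ⊤ := by
  by_contra hne
  obtain ⟨m, ⟨⟨L, rfl⟩, hL⟩, hmin⟩ := hwo
    {U | U ∈ Set.range Ω ∧ ¬ U ≤ Submodule.span k (⋃ a, B a)} (fun U hU => hU.1)
    ⟨⊤, ⟨⊤, map_top Ω⟩, fun h => hne (top_le_iff.1 h)⟩
  have hlt : ∀ M, Ω M < Ω L → Ω M ≤ Submodule.span k (⋃ a, B a) := fun M hM => by
    by_contra h
    exact (hmin _ ⟨⟨M, rfl⟩, h⟩).not_gt hM
  set L₀ : LowerSet Λ := sInf {M | Ω M = Ω L} with hL₀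
  have hΩL₀ : Ω L₀ = Ω L := by
    rw [hL₀, map_sInf]
    have : Ω '' {M | Ω M = Ω L} = {Ω L} := by
      ext U
      constructor
      · rintro ⟨M, hM, rfl⟩
        exact hM
      · rintro rfl
        exact ⟨L, rfl, rfl⟩
    rw [this, sInf_singleton]
  apply hL
  rw [← hΩL₀, map_eq_iSup_map_Iic]
  refine iSup₂_le fun a ha => (hB a).le_sup_span.trans (sup_le (hlt _ ?_) ?_)
  · have hle : LowerSet.Iio a ≤ L₀ := fun x hx => L₀.lower (le_of_lt hx) ha
    refine lt_of_le_of_ne (hΩL₀ ▸ OrderHomClass.mono Ω hle) fun h => ?_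
    exact lt_irrefl a ((sInf_le h : L₀ ≤ LowerSet.Iio a) ha)
  · exact Submodule.span_mono (Set.subset_iUnion B a)

end Filtration

/-- **Prebases of the successive quotients of a complete lattice homomorphism with
well-ordered image assemble into a basis.** -/
theorem union_of_prebases_is_basis
    {Λ : Type*} [LinearOrder Λ] {k V : Type*} [Field k] [AddCommGroup V] [Module k V]
    (Ω : CompleteLatticeHom (LowerSet Λ) (Submodule k V))
    (hwo : ∀ S ⊆ Set.range (⇑Ω), S.Nonempty → ∃ m ∈ S, ∀ x ∈ S, m ≤ x)
    (B : Λ → Set V)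
    (hB : ∀ a : Λ, IsPrebasis (Ω (LowerSet.Iio a)) (Ω (LowerSet.Iic a)) (B a)) :
    LinearIndependent k (fun v : ↥(⋃ a, B a) => (v : V)) ∧
    Submodule.span k (⋃ a, B a) = ⊤ :=
  ⟨linearIndepOn_id_iUnion_of_isPrebasis (OrderHomClass.mono Ω) hB,
    span_iUnion_eq_top_of_isPrebasis Ω hwo hB⟩
end

section
/- Let T be a well-ordered linearly ordered set, k a field, V a k-vector space, and P := LowerSet T × LowerSet T with the componentwise (product) order. Let Ω : LowerSet P → Submodule k V be a complete lattice homomorphism. For each S ∈ P, let B S be a prebasis of the quotient Ω(LowerSet.Iic S) / Ω(LowerSet.Iio S). Then the union ⋃_{S ∈ P} B S is linearly independent and spans V; that is, it is a basis of V. -/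
/-- The lower sets of a well-ordered set are well-founded under inclusion. -/
theorem LowerSet.wellFoundedLT_of_wellFoundedLT {T : Type*} [LinearOrder T]
    [WellFoundedLT T] : WellFoundedLT (LowerSet T) := by
  refine ⟨WellFounded.wellFounded_iff_has_min.2 fun 𝒮 h𝒮 => ?_⟩
  suffices h : sInf 𝒮 ∈ 𝒮 from ⟨sInf 𝒮, h, fun L hL => (sInf_le hL).not_gt⟩
  by_contra hmem
  have key : ∀ L ∈ 𝒮, ∃ x ∈ L, x ∉ sInf 𝒮 := fun L hL => by
    by_contra! h
    exact hmem ((sInf_le hL).antisymm h ▸ hL)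
  obtain ⟨L₀, hL₀⟩ := h𝒮
  obtain ⟨x₀, -, hx₀⟩ := key L₀ hL₀
  obtain ⟨m, hm, hmin⟩ := WellFounded.has_min (wellFounded_lt (α := T))
    {x | x ∉ sInf 𝒮} ⟨x₀, hx₀⟩
  refine hm (LowerSet.mem_sInf_iff.2 fun L hL => ?_)
  obtain ⟨x, hxL, hx⟩ := key L hL
  exact L.lower (not_lt.1 (hmin x hx)) hxL

namespace IsPrebasis

variable {k V : Type*} [Field k] [AddCommGroup V] [Module k V]
  {U W : Submodule k V} {B : Set V}

theorem span_le (h : IsPrebasis U W B) : Submodule.span k B ≤ W :=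
  Submodule.span_le.2 h.1

theorem linearIndepOn (h : IsPrebasis U W B) : LinearIndepOn k id B :=
  LinearIndependent.of_comp U.mkQ h.2.1

theorem disjoint_span_s11 (h : IsPrebasis U W B) : Disjoint (Submodule.span k B) U := by
  have := Submodule.range_ker_disjoint (f := U.mkQ) (v := fun b : B => (b : V)) h.2.1
  simpa using this

theorem le_sup_span_s11 (h : IsPrebasis U W B) : W ≤ U ⊔ Submodule.span k B := by
  rw [← Submodule.comap_map_mkQ, Submodule.map_span, h.2.2]
  exact Submodule.le_comap_map _ _

end IsPrebasis

section Poset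

variable {P : Type*} [PartialOrder P] {k V : Type*} [Field k] [AddCommGroup V] [Module k V]
  (Ω : CompleteLatticeHom (LowerSet P) (Submodule k V)) {B : P → Set V}

/-- Prebases of the successive quotients of a lattice homomorphism on the lower sets of a poset
have a linearly independent union. -/
theorem linearIndepOn_iUnion_of_isPrebasis
    (hB : ∀ p, IsPrebasis (Ω (LowerSet.Iio p)) (Ω (LowerSet.Iic p)) (B p)) :
    LinearIndepOn k id (⋃ p, B p) := by
  classical
  have finite_union : ∀ s : Finset P, LinearIndepOn k id (⋃ p ∈ s, B p) := by
    intro s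
    induction s using Finset.strongInduction with
    | H s ih =>
      rcases s.eq_empty_or_nonempty with rfl | hs
      · simp
      obtain ⟨p, hp⟩ := s.exists_maximal hs
      have hrest : Submodule.span k (⋃ q ∈ s.erase p, B q) ≤ Ω (UpperSet.Ici p).compl := by
        refine Submodule.span_le.2 (Set.iUnion₂_subset fun q hq => (hB q).1.trans ?_)
        refine OrderHomClass.mono Ω fun x hx hpx => ?_
        exact (Finset.mem_erase.1 hq).1
          (hp.eq_of_le (Finset.mem_erase.1 hq).2 (le_trans hpx hx)).symm
      have hmeet : Ω (LowerSet.Iic p) ⊓ Ω (UpperSet.Ici p).compl ≤ Ω (LowerSet.Iio p) := by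
        rw [← map_inf]
        exact OrderHomClass.mono Ω fun x hx => lt_of_le_not_ge hx.1 hx.2
      have hdisj : Disjoint (Submodule.span k (B p))
          (Submodule.span k (⋃ q ∈ s.erase p, B q)) := by
        rw [disjoint_iff_inf_le, ← (hB p).disjoint_span_s11.eq_bot]
        exact le_inf inf_le_left ((inf_le_inf (hB p).span_le hrest).trans hmeet)
      rw [← Finset.insert_erase hp.prop, Finset.set_biUnion_insert]
      exact (hB p).linearIndepOn.id_union (ih _ (Finset.erase_ssubset hp.prop)) hdisj
  rw [Set.iUnion_eq_iUnion_finset]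
  refine linearIndepOn_iUnion_of_directed (directed_of_isDirected_le fun s t hst => ?_)
    finite_union
  exact Set.biUnion_subset_biUnion_left hst

/-- Prebases of the successive quotients of a complete lattice homomorphism on the lower sets of
a well-founded poset have a spanning union. -/
theorem span_iUnion_eq_top_of_isPrebasis_s11 [WellFoundedLT P]
    (hB : ∀ p, IsPrebasis (Ω (LowerSet.Iio p)) (Ω (LowerSet.Iic p)) (B p)) :
    Submodule.span k (⋃ p, B p) = ⊤ := by
  have hle : ∀ p, Ω (LowerSet.Iic p) ≤ Submodule.span k (⋃ p, B p) := by
    intro p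
    induction p using WellFoundedLT.induction with
    | ind p ih =>
      refine (hB p).le_sup_span_s11.trans
        (sup_le ?_ (Submodule.span_mono (Set.subset_iUnion B p)))
      rw [← LowerSet.lowerClosure (LowerSet.Iio p), ← LowerSet.iSup_Iic, map_iSup₂]
      exact iSup₂_le ih
  rw [eq_top_iff, ← map_top Ω, ← LowerSet.lowerClosure (⊤ : LowerSet P), ← LowerSet.iSup_Iic,
    map_iSup₂]
  exact iSup₂_le fun p _ => hle p

end Poset

/-- **Prebases for a complete lattice homomorphism on down-sets of a well-ordered
bifiltration poset assemble into a basis.** -/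
theorem union_of_prebases_is_basis_bifiltration
    {T : Type*} [LinearOrder T]
    (hwoT : ∀ S : Set T, S.Nonempty → ∃ m ∈ S, ∀ x ∈ S, m ≤ x)
    {k V : Type*} [Field k] [AddCommGroup V] [Module k V]
    (Ω : CompleteLatticeHom (LowerSet (LowerSet T × LowerSet T)) (Submodule k V))
    (B : LowerSet T × LowerSet T → Set V)
    (hB : ∀ S : LowerSet T × LowerSet T,
      IsPrebasis (Ω (LowerSet.Iio S)) (Ω (LowerSet.Iic S)) (B S)) :
    LinearIndependent k (fun v : ↥(⋃ S, B S) => (v : V)) ∧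
    Submodule.span k (⋃ S, B S) = ⊤ := by
  have : WellFoundedLT T := ⟨WellFounded.wellFounded_iff_has_min.2 fun S hS =>
    (hwoT S hS).imp fun m hm => ⟨hm.1, fun x hx => not_lt.2 (hm.2 x hx)⟩⟩
  have : WellFoundedLT (LowerSet T) := LowerSet.wellFoundedLT_of_wellFoundedLT
  exact ⟨linearIndepOn_iUnion_of_isPrebasis Ω hB, span_iUnion_eq_top_of_isPrebasis_s11 Ω hB⟩
end

section
/- Let T be a well-ordered linearly ordered set and let ⊑ be a linear order on T × T that extends the componentwise order (that is, a₁ ≤ b₁ and a₂ ≤ b₂ imply (a₁,a₂) ⊑ (b₁,b₂)). Then ⊑ is a well order: every nonempty subset of T × T has a ⊑-least element. -/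
/-- **Every linearization of the product of two copies of a well-ordered set is a well
order.** -/
theorem linearization_of_prod_wellOrdered {T : Type*} [LinearOrder T]
    (hwo : ∀ S : Set T, S.Nonempty → ∃ m ∈ S, ∀ x ∈ S, m ≤ x)
    (L : LinearOrder (T × T))
    (hext : ∀ a b : T × T, a.1 ≤ b.1 → a.2 ≤ b.2 → L.le a b) :
    ∀ S : Set (T × T), S.Nonempty → ∃ m ∈ S, ∀ x ∈ S, L.le m x := by
  have hT : WellFoundedLT T := ⟨WellFounded.wellFounded_iff_has_min.2 fun S hS =>
    (hwo S hS).imp fun m hm => ⟨hm.1, fun x hx => (hm.2 x hx).not_gt⟩⟩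
  have hprod : WellQuasiOrdered fun a b : T × T => a.1 ≤ b.1 ∧ a.2 ≤ b.2 :=
    wellQuasiOrdered_le.prod wellQuasiOrdered_le
  have hL : WellQuasiOrdered L.le := fun f =>
    let ⟨m, n, hmn, h⟩ := hprod f
    ⟨m, n, hmn, hext _ _ h.1 h.2⟩
  have hpre : IsPreorder (T × T) L.le := { refl := L.le_refl, trans := L.le_trans }
  intro S hS
  obtain ⟨m, hm, hmin⟩ := hL.wellFounded.has_min S hS
  refine ⟨m, hm, fun x hx => ?_⟩
  by_contra h
  exact hmin x hx ⟨(L.le_total m x).resolve_left h, h⟩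
end

section
/- Let T be a well-ordered linearly ordered set and let ⊑ be a linear order on LowerSet T × LowerSet T that extends the componentwise inclusion order (that is, S₁ ⊆ S₁' and S₂ ⊆ S₂' imply (S₁,S₂) ⊑ (S₁',S₂')). Then ⊑ is a well order: every nonempty subset of LowerSet T × LowerSet T has a ⊑-least element. -/
/-- A linear order extending a well-quasi-order is a well order. -/
theorem WellQuasiOrdered.exists_least_of_linearOrder {α : Type*} [LinearOrder α]
    {r : α → α → Prop} (hr : WellQuasiOrdered r) (hle : ∀ a b, r a b → a ≤ b)
    {S : Set α} (hS : S.Nonempty) : ∃ m ∈ S, ∀ x ∈ S, m ≤ x := by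
  have : WellQuasiOrderedLE α := ⟨fun f =>
    let ⟨m, n, hmn, h⟩ := hr f
    ⟨m, n, hmn, hle _ _ h⟩⟩
  obtain ⟨m, hm, hmin⟩ := (wellFounded_lt (α := α)).has_min S hS
  exact ⟨m, hm, fun x hx => le_of_not_gt (hmin x hx)⟩

/-- **Every linearization of `LowerSet T × LowerSet T` for a well-ordered `T` is a well
order.** -/
theorem linearization_of_lowerSet_prod_wellOrdered {T : Type*} [LinearOrder T]
    (hwo : ∀ S : Set T, S.Nonempty → ∃ m ∈ S, ∀ x ∈ S, m ≤ x)
    (L : LinearOrder (LowerSet T × LowerSet T))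
    (hext : ∀ a b : LowerSet T × LowerSet T, a.1 ≤ b.1 → a.2 ≤ b.2 → L.le a b) :
    ∀ S : Set (LowerSet T × LowerSet T), S.Nonempty → ∃ m ∈ S, ∀ x ∈ S, L.le m x := by
  have : WellFoundedLT T := ⟨WellFounded.wellFounded_iff_has_min.2 fun S hS =>
    let ⟨m, hm, hmin⟩ := hwo S hS
    ⟨m, hm, fun x hx => not_lt_of_ge (hmin x hx)⟩⟩
  have : WellFoundedLT (LowerSet T) := LowerSet.wellFoundedLT_of_wellFoundedLT
  have hwqo : WellQuasiOrdered fun a b : LowerSet T => a ≤ b := wellQuasiOrdered_le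
  exact fun S hS => (hwqo.prod hwqo).exists_least_of_linearOrder
    (fun a b h => hext a b h.1 h.2) hS
end

section
/- Let α and β be linearly ordered sets satisfying the ascending chain condition (there is no strictly increasing infinite sequence; equivalently, > is well-founded). Equip α ⊕ β with the disjoint-union partial order. Then every element S of LowerSet (LowerSet (α ⊕ β)) is a finite union of principal lower sets: there exists a finite set F of lower sets of α ⊕ β such that S is the supremum (union) of the principal lower sets LowerSet.Iic X for X ∈ F. -/
/-- In a linear order with the ascending chain condition, every lower set is either empty or
principal. -/
theorem LowerSet.exists_withBot_forall_mem_iff {α : Type*} [LinearOrder α] [WellFoundedGT α]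
    (s : LowerSet α) : ∃ a : WithBot α, ∀ x : α, x ∈ s ↔ (x : WithBot α) ≤ a := by
  rcases (s : Set α).eq_empty_or_nonempty with hs | hs
  · refine ⟨⊥, fun x => ⟨fun hx => ?_, fun hx => ?_⟩⟩
    · exact absurd (hs ▸ hx : x ∈ (∅ : Set α)) (Set.notMem_empty x)
    · simp at hx
  · obtain ⟨m, hm, hmax⟩ := wellFounded_gt.has_min (s : Set α) hs
    refine ⟨m, fun x => ⟨fun hx => ?_, fun hx => ?_⟩⟩
    · exact WithBot.coe_le_coe.2 (not_lt.1 (hmax x hx))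
    · exact s.lower (WithBot.coe_le_coe.1 hx) hm

/-- The lower set of `α ⊕ β` consisting of the elements of `α` below `a` and the elements of
`β` below `b`. -/
def LowerSet.sumIic {α β : Type*} [Preorder α] [Preorder β] (a : WithBot α) (b : WithBot β) :
    LowerSet (α ⊕ β) where
  carrier := {z | Sum.elim (fun x : α => (x : WithBot α) ≤ a) (fun y : β => (y : WithBot β) ≤ b) z}
  lower' := by
    rintro (x | x) (y | y) hyx hx
    · exact (WithBot.coe_le_coe.2 (Sum.inl_le_inl_iff.1 hyx)).trans hx
    · exact absurd hyx Sum.not_inr_le_inl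
    · exact absurd hyx Sum.not_inl_le_inr
    · exact (WithBot.coe_le_coe.2 (Sum.inr_le_inr_iff.1 hyx)).trans hx

/-- Every lower set of a disjoint union of two chains with the ascending chain condition is
cut out by a bound on each summand. -/
theorem LowerSet.exists_sumIic_eq {α β : Type*} [LinearOrder α] [LinearOrder β]
    [WellFoundedGT α] [WellFoundedGT β] (s : LowerSet (α ⊕ β)) :
    ∃ a b, LowerSet.sumIic a b = s := by
  obtain ⟨a, ha⟩ := LowerSet.exists_withBot_forall_mem_iff
    (⟨Sum.inl ⁻¹' (s : Set (α ⊕ β)), fun _ _ h hx => s.lower (Sum.inl_le_inl_iff.2 h) hx⟩ :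
      LowerSet α)
  obtain ⟨b, hb⟩ := LowerSet.exists_withBot_forall_mem_iff
    (⟨Sum.inr ⁻¹' (s : Set (α ⊕ β)), fun _ _ h hx => s.lower (Sum.inr_le_inr_iff.2 h) hx⟩ :
      LowerSet β)
  refine ⟨a, b, LowerSet.ext (Set.ext ?_)⟩
  rintro (x | y)
  · exact (ha x).symm
  · exact (hb y).symm

/-- The lower sets of a disjoint union of two chains with the ascending chain condition are
well-quasi-ordered by reverse inclusion. -/
theorem LowerSet.wellQuasiOrderedLE_orderDual_sum {α β : Type*} [LinearOrder α] [LinearOrder β]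
    [WellFoundedGT α] [WellFoundedGT β] : WellQuasiOrderedLE (LowerSet (α ⊕ β))ᵒᵈ := by
  refine Monotone.wellQuasiOrderedLE_of_wellQuasiOrderedLE_of_surjective
    (f := fun p : (WithBot α)ᵒᵈ × (WithBot β)ᵒᵈ =>
      OrderDual.toDual (LowerSet.sumIic (OrderDual.ofDual p.1) (OrderDual.ofDual p.2))) ?_ ?_
  · rintro ⟨a, b⟩ ⟨c, d⟩ ⟨hac, hbd⟩ (x | y) hz
    · exact le_trans (α := WithBot α) hz hac
    · exact le_trans (α := WithBot β) hz hbd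
  · intro s
    obtain ⟨a, b, h⟩ := LowerSet.exists_sumIic_eq (OrderDual.ofDual s)
    exact ⟨(OrderDual.toDual a, OrderDual.toDual b), congrArg OrderDual.toDual h⟩

/-- If the dual of `P` is well-quasi-ordered, every lower set of `P` is a finite union of
principal lower sets. -/
theorem LowerSet.exists_finset_eq_sup_Iic {P : Type*} [PartialOrder P]
    [WellQuasiOrderedLE Pᵒᵈ] (S : LowerSet P) :
    ∃ F : Finset P, S = F.sup (fun X => LowerSet.Iic X) := by
  have hfin : {x | Maximal (· ∈ S) x}.Finite :=
    WellQuasiOrderedLE.finite_of_isAntichain (α := Pᵒᵈ) (setOfPred_maximal_antichain (· ∈ S)).to_dual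
  have : WellFoundedGT P := wellFoundedLT_dual_iff P |>.1 inferInstance
  refine ⟨hfin.toFinset, le_antisymm (fun x hx => ?_) (Finset.sup_le fun X hX => ?_)⟩
  · obtain ⟨m, hxm, hm⟩ := exists_maximal_ge_of_wellFoundedGT (· ∈ S) x hx
    exact Finset.le_sup (f := fun X => LowerSet.Iic X) (hfin.mem_toFinset.2 hm) hxm
  · exact LowerSet.Iic_le.2 (hfin.mem_toFinset.1 hX).prop

/-- **Finite generation in the double lower-set lattice of a disjoint union of two chains
with ACC.**  If `α` and `β` are linearly ordered sets in which `>` is well-founded, then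
every element of `LowerSet (LowerSet (α ⊕ β))` (with the disjoint-union order on `α ⊕ β`)
is a finite union of principal lower sets. -/
theorem lowerSet_lowerSet_sum_finite_union_principal
    {α β : Type*} [LinearOrder α] [LinearOrder β]
    (hα : WellFounded ((· > ·) : α → α → Prop))
    (hβ : WellFounded ((· > ·) : β → β → Prop)) :
    ∀ S : LowerSet (LowerSet (α ⊕ β)), ∃ F : Finset (LowerSet (α ⊕ β)),
      S = F.sup (fun X => LowerSet.Iic X) := by
  have : WellFoundedGT α := ⟨hα⟩
  have : WellFoundedGT β := ⟨hβ⟩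
  have := LowerSet.wellQuasiOrderedLE_orderDual_sum (α := α) (β := β)
  exact LowerSet.exists_finset_eq_sup_Iic
end

section
/- Let k be a field and V a k-vector space. The following are equivalent: (1) V is finite-dimensional over k; (2) for every pair of chains C₁, C₂ in the lattice Submodule k V of subspaces of V, there exists a subset S ⊆ Submodule k V with C₁ ∪ C₂ ⊆ S such that S is closed under arbitrary suprema and infima (for every T ⊆ S, sSup T ∈ S and sInf T ∈ S) and S is completely distributive: for every index type ι, every family of index types κ : ι → Type, and every doubly indexed family f with f i j ∈ S for all i and all j : κ i, one has ⨅ i, ⨆ j, f i j = ⨆ (g : Π i, κ i), ⨅ i, f i (g i), all suprema and infima computed in Submodule k V. -/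
universe u w

/-- Two chains of subspaces of a finite-dimensional space `P` admit a common adapted basis. -/
lemma exists_linearIndepOn_adapted_of_isChain {k V : Type*} [Field k] [AddCommGroup V] [Module k V]
    [FiniteDimensional k V] (P : Submodule k V) :
    ∀ C₁ C₂ : Set (Submodule k V), IsChain (· ≤ ·) C₁ → IsChain (· ≤ ·) C₂ →
      (∀ U ∈ C₁ ∪ C₂, U ≤ P) →
      ∃ B : Set V, LinearIndepOn k id B ∧ Submodule.span k B = P ∧
        ∀ U ∈ C₁ ∪ C₂, ∃ A ⊆ B, U = Submodule.span k A := by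
  induction P using WellFoundedLT.induction with
  | ind P ih =>
  intro C₁ C₂ h₁ h₂ hP
  by_cases hbot : P = ⊥
  · subst hbot
    refine ⟨∅, linearIndepOn_empty k id, Submodule.span_empty, fun U hU => ⟨∅, subset_rfl, ?_⟩⟩
    rw [Submodule.span_empty, eq_bot_iff]
    exact hP U hU
  -- a hyperplane of `P` containing every proper member of `C₁`
  obtain ⟨H, hH, hC₁⟩ : ∃ H, H ⋖ P ∧ ∀ U ∈ C₁, U ≠ P → U ≤ H := by
    obtain ⟨M, hM, hMC⟩ : ∃ M, M < P ∧ ∀ U ∈ C₁, U ≠ P → U ≤ M := by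
      by_cases hne : {U ∈ C₁ | U ≠ P}.Nonempty
      · obtain ⟨M, ⟨hMC, hMP⟩, hmax⟩ := WellFounded.has_min wellFounded_gt _ hne
        refine ⟨M, lt_of_le_of_ne (hP M (Or.inl hMC)) hMP, fun U hU hUP => ?_⟩
        rcases h₁.total hU hMC with h | h
        · exact h
        · exact (eq_of_le_of_not_lt h (hmax U ⟨hU, hUP⟩)).ge
      · exact ⟨⊥, bot_lt_iff_ne_bot.2 hbot, fun U hU hUP => (hne ⟨U, hU, hUP⟩).elim⟩
    obtain ⟨H, hH, hMH⟩ := exists_le_covBy_of_lt hM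
    exact ⟨H, hMH, fun U hU hUP => (hMC U hU hUP).trans hH⟩
  -- a vector outside `H` lying in every member of `C₂` not contained in `H`
  obtain ⟨v, hvP, hvH, hC₂⟩ : ∃ v ∈ P, v ∉ H ∧ ∀ U ∈ C₂, ¬ U ≤ H → v ∈ U := by
    by_cases hne : {U ∈ C₂ | ¬ U ≤ H}.Nonempty
    · obtain ⟨M, ⟨hMC, hMH⟩, hmin⟩ := WellFounded.has_min wellFounded_lt _ hne
      obtain ⟨v, hvM, hvH⟩ := SetLike.not_le_iff_exists.1 hMH
      refine ⟨v, hP M (Or.inr hMC) hvM, hvH, fun U hU hUH => ?_⟩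
      rcases h₂.total hMC hU with h | h
      · exact h hvM
      · exact (eq_of_le_of_not_lt h (hmin U ⟨hU, hUH⟩)).ge hvM
    · obtain ⟨v, hvP, hvH⟩ := SetLike.exists_of_lt hH.lt
      exact ⟨v, hvP, hvH, fun U hU hUH => (hne ⟨U, hU, hUH⟩).elim⟩
  have hsup : H ⊔ Submodule.span k {v} = P := by
    refine (hH.eq_or_eq le_sup_left (sup_le hH.le ?_)).resolve_left fun h => hvH ?_
    · simpa using hvP
    · rw [← h]
      exact Submodule.mem_sup_right (Submodule.mem_span_singleton_self v)
  have hinf : Monotone fun U : Submodule k V => U ⊓ H := fun _ _ h => inf_le_inf_right H h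
  obtain ⟨B, hB, hBH, hBC⟩ := ih H hH.lt _ _
    (hinf.isChain_image h₁) (hinf.isChain_image h₂)
    (by rintro _ (⟨U, -, rfl⟩ | ⟨U, -, rfl⟩) <;> exact inf_le_right)
  have hspan : Submodule.span k (insert v B) = P := by
    rw [Submodule.span_insert, hBH, sup_comm, hsup]
  refine ⟨insert v B, hB.id_insert (by rwa [hBH]), hspan, fun U hU => ?_⟩
  by_cases hUH : U ≤ H
  · obtain ⟨A, hA, hUA⟩ := hBC (U ⊓ H) (hU.imp (fun h => ⟨U, h, rfl⟩) (fun h => ⟨U, h, rfl⟩))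
    exact ⟨A, hA.trans (Set.subset_insert v B), by rw [← hUA, inf_eq_left.2 hUH]⟩
  rcases hU with hU | hU
  · refine ⟨insert v B, subset_rfl, ?_⟩
    rw [hspan]
    by_contra hUP
    exact hUH (hC₁ U hU hUP)
  · obtain ⟨A, hA, hUA⟩ := hBC (U ⊓ H) (Or.inr ⟨U, hU, rfl⟩)
    refine ⟨insert v A, Set.insert_subset_insert hA, ?_⟩
    have hvU : Submodule.span k {v} ≤ U := by simpa using hC₂ U hU hUH
    rw [Submodule.span_insert, ← hUA, sup_comm, inf_sup_assoc_of_le H hvU, hsup]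
    exact (inf_eq_left.2 (hP U (Or.inr hU))).symm

namespace Module.Basis

variable {ι k V : Type*} [Field k] [AddCommGroup V] [Module k V] (b : Basis ι k V)

lemma span_image_iInter {α : Sort*} (A : α → Set ι) :
    Submodule.span k (b '' ⋂ a, A a) = ⨅ a, Submodule.span k (b '' A a) := by
  ext x
  simp only [Submodule.mem_iInf, b.mem_span_image, Set.subset_iInter_iff]

lemma span_image_iUnion {α : Sort*} (A : α → Set ι) :
    Submodule.span k (b '' ⋃ a, A a) = ⨆ a, Submodule.span k (b '' A a) := by
  rw [Set.image_iUnion, Submodule.span_iUnion]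

/-- The subspaces spanned by subsets of a basis satisfy the complete distributive law. -/
lemma iInf_iSup_eq_of_mem_range_span_image {α : Type*} {κ : α → Type*}
    (f : ∀ i, κ i → Submodule k V)
    (hf : ∀ i j, f i j ∈ Set.range fun A : Set ι => Submodule.span k (b '' A)) :
    ⨅ i, ⨆ j, f i j = ⨆ g : ∀ i, κ i, ⨅ i, f i (g i) := by
  choose A hA using hf
  simp only [← hA, ← span_image_iInter, ← span_image_iUnion]
  congr 2
  ext x
  simp only [Set.mem_iInter, Set.mem_iUnion]
  exact Classical.skolem

end Module.Basis

/-- In an infinite-dimensional space there are a descending sequence of subspaces with trivial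
intersection and a proper subspace supplementing every member of the sequence. -/
lemma exists_antitone_iInf_eq_bot_sup_eq_top {k V : Type*} [Field k] [AddCommGroup V] [Module k V]
    (h : ¬ FiniteDimensional k V) :
    ∃ (A : ℕ → Submodule k V) (H : Submodule k V), Antitone A ∧ ⨅ n, A n = ⊥ ∧ H ≠ ⊤ ∧
      ∀ n, A n ⊔ H = ⊤ := by
  let b := Module.Basis.ofVectorSpace k V
  have : Infinite (Module.Basis.ofVectorSpaceIndex k V) := by
    by_contra hfin
    rw [not_infinite_iff_finite] at hfin
    exact h (Module.Finite.of_basis b)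
  let e := Infinite.natEmbedding (Module.Basis.ofVectorSpaceIndex k V)
  have hcoord (i) : b.sumCoords (b i) = 1 := b.sumCoords_self_apply i
  refine ⟨fun n => Submodule.span k (b '' (e '' Set.Ici n)), LinearMap.ker b.sumCoords,
    fun m n hmn => Submodule.span_mono (Set.image_mono (Set.image_mono (Set.Ici_subset_Ici.2 hmn))),
    ?_, fun htop => ?_, fun n => ?_⟩
  · rw [← b.span_image_iInter, ← e.injective.injOn.image_iInter_eq]
    have : ⋂ n : ℕ, Set.Ici n = ∅ := by
      ext m
      simpa using ⟨m + 1, m.lt_succ_self⟩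
    simp [this]
  · have h0 := LinearMap.mem_ker.1 (htop.ge (Submodule.mem_top (x := b (e 0))))
    rw [hcoord] at h0
    exact one_ne_zero h0
  · refine eq_top_iff.2 fun x _ => ?_
    rw [← add_sub_cancel (b.sumCoords x • b (e n)) x]
    refine Submodule.add_mem_sup (Submodule.smul_mem _ _ (Submodule.subset_span ?_)) ?_
    · exact Set.mem_image_of_mem b (Set.mem_image_of_mem e Set.self_mem_Ici)
    · rw [LinearMap.mem_ker, map_sub, map_smul, hcoord, smul_eq_mul, mul_one, sub_self]

/-- **Finite-dimensionality is equivalent to CD extension of arbitrary bifiltrations.**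
A `k`-vector space `V` is finite-dimensional iff every pair of chains in `Submodule k V`
extends to a sup/inf-closed, completely distributive subset of `Submodule k V`. -/
theorem finiteDimensional_iff_chains_extend_to_completelyDistributive
    {k V : Type*} [Field k] [AddCommGroup V] [Module k V] :
    FiniteDimensional k V ↔
    (∀ C₁ C₂ : Set (Submodule k V), IsChain (· ≤ ·) C₁ → IsChain (· ≤ ·) C₂ →
      ∃ S : Set (Submodule k V), C₁ ∪ C₂ ⊆ S ∧
        (∀ T ⊆ S, sSup T ∈ S ∧ sInf T ∈ S) ∧
        (∀ (ι : Type u) (κ : ι → Type w) (f : ∀ i, κ i → Submodule k V),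
          (∀ i j, f i j ∈ S) →
          ⨅ i, ⨆ j, f i j = ⨆ g : ∀ i, κ i, ⨅ i, f i (g i))) := by
  refine ⟨fun _ C₁ C₂ h₁ h₂ => ?_, fun h => ?_⟩
  · obtain ⟨B, hB, hspan, hBC⟩ :=
      exists_linearIndepOn_adapted_of_isChain ⊤ C₁ C₂ h₁ h₂ fun _ _ => le_top
    let b : Module.Basis B k V := Module.Basis.mk hB (by simp [hspan])
    have hb : ⇑b = Subtype.val := by ext x; simp [b]
    refine ⟨Set.range fun A : Set B => Submodule.span k (b '' A), fun U hU => ?_, fun T hT => ?_,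
      fun _ _ f hf => b.iInf_iSup_eq_of_mem_range_span_image f hf⟩
    · obtain ⟨A, hA, rfl⟩ := hBC U hU
      refine ⟨Subtype.val ⁻¹' A, ?_⟩
      simp only [hb, Subtype.image_preimage_coe, Set.inter_eq_right.2 hA]
    · choose A hA using fun U : T => hT U.2
      rw [sSup_eq_iSup', sInf_eq_iInf']
      refine ⟨⟨⋃ U, A U, ?_⟩, ⟨⋂ U, A U, ?_⟩⟩
      · simp only [b.span_image_iUnion, hA]
      · simp only [b.span_image_iInter, hA]
  · by_contra hfin
    obtain ⟨A, H, hA, hbot, htop, hsup⟩ := exists_antitone_iInf_eq_bot_sup_eq_top hfin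
    obtain ⟨S, hS, -, hdist⟩ := h (Set.range A) {H} hA.isChain_range IsChain.singleton
    have key := hdist (ULift ℕ) (fun _ => ULift Bool) (fun n j => bif j.down then A n.down else H)
      (by
        rintro ⟨n⟩ ⟨_ | _⟩
        · exact hS (Or.inr rfl)
        · exact hS (Or.inl ⟨n, rfl⟩))
    refine htop (top_le_iff.1 ?_)
    calc ⊤ ≤ ⨅ n : ULift ℕ, ⨆ j : ULift Bool, bif j.down then A n.down else H :=
          le_iInf fun n => (hsup n.down).ge.trans
            (sup_le (le_iSup_of_le ⟨true⟩ le_rfl) (le_iSup_of_le ⟨false⟩ le_rfl))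
      _ = _ := key
      _ ≤ H := iSup_le fun g => by
          by_cases hg : ∃ n, (g n).down = false
          · obtain ⟨n, hn⟩ := hg
            exact iInf_le_of_le n (by simp [hn])
          · have hg' : ∀ n, (g n).down = true := by simpa using hg
            refine le_trans (le_trans (le_iInf fun n => ?_) hbot.le) bot_le
            exact iInf_le_of_le ⟨n⟩ (by simp [hg'])
end
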